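/- arXiv:math-ph/0006001 — 10 statements merged into one kernel-verified Lean document; each statement's English description precedes it below -/
import Mathlib

section
/- Let (A,B,C) and (Ã,B̃,C̃) be admissible triples of real numbers, let U ⊆ ℝ³ be open, and let (w,v) be a pair of C¹ nondegenerate functions on U satisfying the Bäcklund system. Let τ₁ be a C¹ function with nowhere-vanishing derivative on an open interval containing w(U), and τ₂ a C¹ function with nowhere-vanishing derivative on an open interval containing v(U). Then the pair (τ₁∘w, τ₂∘v) is again nondegenerate and satisfies the Bäcklund system on U. (Theorem 5.50, part 2.) -/
noncomputable section

/-- ℝ³ as a Euclidean space. -/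
abbrev R3 := EuclideanSpace ℝ (Fin 3)

/-- Partial derivative of `f` in the `i`-th coordinate direction. -/
def pd (i : Fin 3) (f : R3 → ℝ) (p : R3) : ℝ :=
  fderiv ℝ f p (EuclideanSpace.single i 1)

/-- A triple (A,B,C) is admissible if all entries are nonzero and they sum to zero. -/
def Admissible (A B C : ℝ) : Prop := A ≠ 0 ∧ B ≠ 0 ∧ C ≠ 0 ∧ A + B + C = 0

/-- `f` is nondegenerate on `U` : all three first partials vanish nowhere on `U`. -/
def Nondeg (f : R3 → ℝ) (U : Set R3) : Prop :=
  ∀ p ∈ U, pd 0 f p ≠ 0 ∧ pd 1 f p ≠ 0 ∧ pd 2 f p ≠ 0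

/-- The Bäcklund system (5.60) for the pair (w,v) on `U`. -/
def Backlund (A B C A' B' C' : ℝ) (w v : R3 → ℝ) (U : Set R3) : Prop :=
  ∀ p ∈ U,
    A * B' * pd 0 w p * pd 1 v p = A' * B * pd 1 w p * pd 0 v p ∧
    A * C' * pd 0 w p * pd 2 v p = A' * C * pd 2 w p * pd 0 v p

/-- Chain rule for the partial derivatives of `τ ∘ f`. -/
theorem pd_comp (i : Fin 3) {τ : ℝ → ℝ} {f : R3 → ℝ} {p : R3}
    (hτ : DifferentiableAt ℝ τ (f p)) (hf : DifferentiableAt ℝ f p) :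
    pd i (fun q => τ (f q)) p = deriv τ (f p) * pd i f p := by
  have h : HasFDerivAt (fun q => τ (f q)) (deriv τ (f p) • fderiv ℝ f p) p :=
    hτ.hasDerivAt.comp_hasFDerivAt p hf.hasFDerivAt
  simp [pd, h.fderiv]

theorem pd_comp_of_contDiffOn {U : Set R3} (hU : IsOpen U) {f : R3 → ℝ}
    (hf : ContDiffOn ℝ 1 f U) {I : Set ℝ} (hI : IsOpen I) (hfI : f '' U ⊆ I) {τ : ℝ → ℝ}
    (hτ : ContDiffOn ℝ 1 τ I) {p : R3} (hp : p ∈ U) (i : Fin 3) :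
    pd i (fun q => τ (f q)) p = deriv τ (f p) * pd i f p :=
  pd_comp i
    ((hτ.differentiableOn one_ne_zero).differentiableAt (hI.mem_nhds (hfI ⟨p, hp, rfl⟩)))
    ((hf.differentiableOn one_ne_zero).differentiableAt (hU.mem_nhds hp))

theorem Nondeg.comp {U : Set R3} (hU : IsOpen U) {f : R3 → ℝ}
    (hf : ContDiffOn ℝ 1 f U) (hfn : Nondeg f U) {I : Set ℝ} (hI : IsOpen I) (hfI : f '' U ⊆ I)
    {τ : ℝ → ℝ} (hτ : ContDiffOn ℝ 1 τ I) (hτ' : ∀ t ∈ I, deriv τ t ≠ 0) :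
    Nondeg (fun p => τ (f p)) U := by
  intro p hp
  simp only [pd_comp_of_contDiffOn hU hf hI hfI hτ hp]
  have h := hτ' (f p) (hfI ⟨p, hp, rfl⟩)
  obtain ⟨h0, h1, h2⟩ := hfn p hp
  exact ⟨mul_ne_zero h h0, mul_ne_zero h h1, mul_ne_zero h h2⟩

/-- Theorem 5.50, part 2: the Bäcklund system is invariant under gauge transforms
of each of the two functions. -/
theorem backlund_gauge_invariant
    (A B C A' B' C' : ℝ) (hABC : Admissible A B C) (hABC' : Admissible A' B' C')
    (U : Set R3) (hU : IsOpen U)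
    (w v : R3 → ℝ) (hw : ContDiffOn ℝ 1 w U) (hv : ContDiffOn ℝ 1 v U)
    (hwn : Nondeg w U) (hvn : Nondeg v U)
    (hB : Backlund A B C A' B' C' w v U)
    (τ₁ τ₂ : ℝ → ℝ) (I₁ I₂ : Set ℝ)
    (hI₁ : IsOpen I₁) (hI₁c : I₁.OrdConnected) (hwI : w '' U ⊆ I₁)
    (hI₂ : IsOpen I₂) (hI₂c : I₂.OrdConnected) (hvI : v '' U ⊆ I₂)
    (hτ₁ : ContDiffOn ℝ 1 τ₁ I₁) (hτ₁' : ∀ t ∈ I₁, deriv τ₁ t ≠ 0)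
    (hτ₂ : ContDiffOn ℝ 1 τ₂ I₂) (hτ₂' : ∀ t ∈ I₂, deriv τ₂ t ≠ 0) :
    Nondeg (fun p => τ₁ (w p)) U ∧ Nondeg (fun p => τ₂ (v p)) U ∧
      Backlund A B C A' B' C' (fun p => τ₁ (w p)) (fun p => τ₂ (v p)) U := by
  refine ⟨.comp hU hw hwn hI₁ hwI hτ₁ hτ₁', Nondeg.comp hU hv hvn hI₂ hvI hτ₂ hτ₂', fun p hp => ?_⟩
  simp only [pd_comp_of_contDiffOn hU hw hI₁ hwI hτ₁ hp,
    pd_comp_of_contDiffOn hU hv hI₂ hvI hτ₂ hp]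
  obtain ⟨hy, hz⟩ := hB p hp
  constructor
  · linear_combination deriv τ₁ (w p) * deriv τ₂ (v p) * hy
  · linear_combination deriv τ₁ (w p) * deriv τ₂ (v p) * hz
end
end

section
/- Let (A,B,C) and (Ã,B̃,C̃) be admissible triples of real numbers with A·B̃ ≠ Ã·B, let U ⊆ ℝ³ be open, and let w, v : U → ℝ be C² nondegenerate functions such that (w,v) satisfies the Bäcklund system on U. Then w satisfies the (A,B,C)-equation on U, i.e. A·w_x·w_{yz} + B·w_y·w_{xz} + C·w_z·w_{xy} = 0 on U, and v satisfies the (Ã,B̃,C̃)-equation on U, i.e. Ã·v_x·v_{yz} + B̃·v_y·v_{xz} + C̃·v_z·v_{xy} = 0 on U. (Theorem 5.50, part 3.) -/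
noncomputable section

/-- `w` satisfies the (A,B,C)-equation `A·w_x·w_{yz} + B·w_y·w_{xz} + C·w_z·w_{xy} = 0` on `U`. -/
def ABCEq (A B C : ℝ) (w : R3 → ℝ) (U : Set R3) : Prop :=
  ∀ p ∈ U,
    A * pd 0 w p * pd 1 (pd 2 w) p + B * pd 1 w p * pd 0 (pd 2 w) p
      + C * pd 2 w p * pd 0 (pd 1 w) p = 0

lemma pd_differentiableAt {f : R3 → ℝ} {p : R3} (hf : ContDiffAt ℝ 2 f p) (i : Fin 3) :
    DifferentiableAt ℝ (pd i f) p := by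
  have h : DifferentiableAt ℝ (fderiv ℝ f) p :=
    (hf.fderiv_right (m := 1) (by norm_num)).differentiableAt (by norm_num)
  exact h.clm_apply (differentiableAt_const _)

lemma pd_comm {f : R3 → ℝ} {p : R3} (hf : ContDiffAt ℝ 2 f p) (i j : Fin 3) :
    pd i (pd j f) p = pd j (pd i f) p := by
  have h : DifferentiableAt ℝ (fderiv ℝ f) p :=
    (hf.fderiv_right (m := 1) (by norm_num)).differentiableAt (by norm_num)
  have key (k l : Fin 3) : pd k (pd l f) p =
      fderiv ℝ (fderiv ℝ f) p (EuclideanSpace.single k 1) (EuclideanSpace.single l 1) := by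
    change fderiv ℝ (fun q => fderiv ℝ f q (EuclideanSpace.single l 1)) p _ = _
    rw [fderiv_clm_apply h (differentiableAt_const _)]
    simp
  rw [key, key]
  exact (hf.isSymmSndFDerivAt (by simp)).eq _ _

lemma pd_const_mul_mul {f g : R3 → ℝ} {p : R3} (hf : DifferentiableAt ℝ f p)
    (hg : DifferentiableAt ℝ g p) (k : Fin 3) (a : ℝ) :
    pd k (fun q => a * f q * g q) p = a * (pd k f p * g p + f p * pd k g p) := by
  unfold pd
  rw [fderiv_fun_mul (hf.const_mul a) hg, fderiv_const_mul hf]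
  simp
  ring

/-- A bilinear relation between differentiable functions on an open set may be differentiated. -/
lemma pd_relation {U : Set R3} (hU : IsOpen U) {a b : ℝ} {f g f' g' : R3 → ℝ}
    (h : ∀ q ∈ U, a * f q * g q = b * f' q * g' q) {p : R3} (hp : p ∈ U)
    (hf : DifferentiableAt ℝ f p) (hg : DifferentiableAt ℝ g p)
    (hf' : DifferentiableAt ℝ f' p) (hg' : DifferentiableAt ℝ g' p) (k : Fin 3) :
    a * (pd k f p * g p + f p * pd k g p) = b * (pd k f' p * g' p + f' p * pd k g' p) := by
  rw [← pd_const_mul_mul hf hg, ← pd_const_mul_mul hf' hg']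
  have : (fun q => a * f q * g q) =ᶠ[nhds p] fun q => b * f' q * g' q := by
    filter_upwards [hU.mem_nhds hp] with q hq using h q hq
  unfold pd
  rw [this.fderiv_eq]

lemma Backlund.symm {A B C A' B' C' : ℝ} {w v : R3 → ℝ} {U : Set R3}
    (h : Backlund A B C A' B' C' w v U) : Backlund A' B' C' A B C v w U := fun p hp => by
  obtain ⟨h₁, h₂⟩ := h p hp
  exact ⟨by linear_combination -h₁, by linear_combination -h₂⟩

/-- The first component of a nondegenerate solution of the Bäcklund system solves its equation. -/
lemma Backlund.abcEq {A B C A' B' C' : ℝ} (hABC : Admissible A B C)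
    (hABC' : Admissible A' B' C') (hne : A * B' ≠ A' * B) {U : Set R3} (hU : IsOpen U)
    {w v : R3 → ℝ} (hw : ContDiffOn ℝ 2 w U) (hv : ContDiffOn ℝ 2 v U)
    (hwn : Nondeg w U) (hvn : Nondeg v U) (hB : Backlund A B C A' B' C' w v U) :
    ABCEq A B C w U := by
  obtain ⟨hA, -, -, hsum⟩ := hABC
  obtain ⟨hA', -, -, hsum'⟩ := hABC'
  have hyz : ∀ q ∈ U, B * C' * pd 1 w q * pd 2 v q = B' * C * pd 2 w q * pd 1 v q := by
    intro q hq
    obtain ⟨h₁, h₂⟩ := hB q hq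
    have hne₀ : A * A' * pd 0 w q * pd 0 v q ≠ 0 :=
      mul_ne_zero (mul_ne_zero (mul_ne_zero hA hA') (hwn q hq).1) (hvn q hq).1
    apply mul_left_cancel₀ hne₀
    linear_combination (A' * B * pd 1 w q * pd 0 v q) * h₂
      - (A' * C * pd 2 w q * pd 0 v q) * h₁
  intro p hp
  have cw := hw.contDiffAt (hU.mem_nhds hp)
  have cv := hv.contDiffAt (hU.mem_nhds hp)
  have dw := pd_differentiableAt cw
  have dv := pd_differentiableAt cv
  have e₁ := pd_relation hU (fun q hq => (hB q hq).1) hp (dw 0) (dv 1) (dw 1) (dv 0) 2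
  have e₂ := pd_relation hU (fun q hq => (hB q hq).2) hp (dw 0) (dv 2) (dw 2) (dv 0) 1
  have e₃ := pd_relation hU hyz hp (dw 1) (dv 2) (dw 2) (dv 1) 0
  rw [pd_comm cw 2 0, pd_comm cw 2 1, pd_comm cv 2 0, pd_comm cv 2 1] at e₁
  rw [pd_comm cw 1 0, pd_comm cv 1 0] at e₂
  obtain ⟨h₁, h₂⟩ := hB p hp
  obtain rfl : C = -A - B := by linarith
  obtain rfl : C' = -A' - B' := by linarith
  have hmix : A' * pd 0 v p * pd 1 (pd 2 w) p + B' * pd 1 v p * pd 0 (pd 2 w) p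
      + (-A' - B') * pd 2 v p * pd 0 (pd 1 w) p = 0 := by
    apply mul_left_cancel₀ (sub_ne_zero.mpr hne.symm)
    linear_combination (-A' - B') * e₁ - B' * e₂ + A' * e₃
  apply mul_left_cancel₀ (mul_ne_zero hA' (hvn p hp).1)
  linear_combination A * pd 0 w p * hmix - pd 0 (pd 2 w) p * h₁ - pd 0 (pd 1 w) p * h₂

/-- Theorem 5.50, part 3: if `(w,v)` solves the Bäcklund system (with
`A·B' ≠ A'·B`), then `w` solves the (A,B,C)-equation and `v` solves the
(A',B',C')-equation. -/
theorem backlund_implies_wave_equations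
    (A B C A' B' C' : ℝ) (hABC : Admissible A B C) (hABC' : Admissible A' B' C')
    (hne : A * B' ≠ A' * B)
    (U : Set R3) (hU : IsOpen U)
    (w v : R3 → ℝ) (hw : ContDiffOn ℝ 2 w U) (hv : ContDiffOn ℝ 2 v U)
    (hwn : Nondeg w U) (hvn : Nondeg v U)
    (hB : Backlund A B C A' B' C' w v U) :
    ABCEq A B C w U ∧ ABCEq A' B' C' v U := by
  exact ⟨hB.abcEq hABC hABC' hne hU hw hv hwn hvn,
    hB.symm.abcEq hABC' hABC hne.symm hU hv hw hvn hwn⟩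
end
end

section
/- Let v and v′ be C¹ nondegenerate functions on an open neighborhood U of the origin in ℝ³, and suppose there is a nowhere-vanishing continuous function ψ : U → ℝ with v_x = ψ·v′_x, v_y = ψ·v′_y and v_z = ψ·v′_z at every point of U. Then there exist ε > 0 with the open ball B_ε(0) ⊆ U and a C¹ function τ, defined on an open interval containing v′(B_ε(0)) and having nowhere-vanishing derivative, such that v = τ∘v′ on B_ε(0); that is, v and v′ are gauge transforms of each other near the origin. (The lemma in the proof of Theorem 5.50.) -/
noncomputable section

open Metric Filter Topology in
/-- If the differentials of two real functions that are C¹ on an open set are proportional via a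
nowhere-vanishing factor and the second one is regular at `a`, then near `a` the first function is a
C¹ function, with nowhere-vanishing derivative, of the second one. -/
theorem exists_eq_comp_of_fderiv_eq_smul {E : Type*} [NormedAddCommGroup E] [NormedSpace ℝ E]
    [CompleteSpace E] {U : Set E} (hU : IsOpen U) {a : E} (ha : a ∈ U) {f g : E → ℝ}
    (hf : ContDiffOn ℝ 1 f U) (hg : ContDiffOn ℝ 1 g U) (hreg : fderiv ℝ g a ≠ 0)
    {ψ : E → ℝ} (hψ : ∀ p ∈ U, ψ p ≠ 0) (hprop : ∀ p ∈ U, fderiv ℝ f p = ψ p • fderiv ℝ g p) :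
    ∃ ε > 0, ball a ε ⊆ U ∧
      ∃ (τ : ℝ → ℝ) (I : Set ℝ), IsOpen I ∧ I.OrdConnected ∧ g '' ball a ε ⊆ I ∧
        ContDiffOn ℝ 1 τ I ∧ (∀ t ∈ I, deriv τ t ≠ 0) ∧ ∀ p ∈ ball a ε, f p = τ (g p) := by
  set L := fderiv ℝ g a
  obtain ⟨e, he⟩ : ∃ e, L e = 1 := by
    obtain ⟨w, hw⟩ : ∃ w, L w ≠ 0 := by
      by_contra! h
      exact hreg (ContinuousLinearMap.ext h)
    exact ⟨(L w)⁻¹ • w, by simp [hw]⟩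
  have he0 : 0 < ‖e‖ := norm_pos_iff.2 (by rintro rfl; simp at he)
  have hfd : ∀ p ∈ U, ContDiffAt ℝ 1 f p := fun p hp => hf.contDiffAt (hU.mem_nhds hp)
  have hgd : ∀ p ∈ U, ContDiffAt ℝ 1 g p := fun p hp => hg.contDiffAt (hU.mem_nhds hp)
  -- The chart `G` turns `g` into the linear functional `L` and has differential `id` at `a`.
  let G : E → E := fun p => p + (g p - L p) • e
  have hLG : ∀ p, L (G p) = g p := fun p => by simp [G, he]
  have hG : ContDiffAt ℝ 1 G a :=
    contDiffAt_id.add (((hgd a ha).sub L.contDiff.contDiffAt).smul contDiffAt_const)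
  have hG' : HasFDerivAt G (ContinuousLinearEquiv.refl ℝ E : E →L[ℝ] E) a := by
    have h1 : HasFDerivAt g L a := ((hgd a ha).differentiableAt one_ne_zero).hasFDerivAt
    have h2 := (hasFDerivAt_id a).add ((h1.sub L.hasFDerivAt).smul_const e)
    have h3 : (ContinuousLinearEquiv.refl ℝ E : E →L[ℝ] E) =
        ContinuousLinearMap.id ℝ E + (L - L).smulRight e := by
      ext x
      simp
    rw [h3]
    exact h2
  let Φ := hG.toOpenPartialHomeomorph G hG' one_ne_zero
  have hΦ : ∀ p, Φ p = G p := fun p => rfl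
  have haΦ : a ∈ Φ.source := hG.mem_toOpenPartialHomeomorph_source hG' one_ne_zero
  have hΦa : Φ.symm (G a) = a := Φ.left_inv haΦ
  have hH : ContDiffAt ℝ 1 Φ.symm (G a) := hG.to_localInverse hG' one_ne_zero
  have hgood : ∀ᶠ q in 𝓝 (G a), q ∈ Φ.target ∧ Φ.symm q ∈ U ∧ ContDiffAt ℝ 1 Φ.symm q := by
    refine Eventually.and (Φ.open_target.mem_nhds (Φ.map_source haΦ)) (Eventually.and ?_ ?_)
    · exact hH.continuousAt (hU.mem_nhds (by rwa [hΦa]))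
    · exact hH.eventually (by simp)
  obtain ⟨r, hr, hball⟩ := Metric.eventually_nhds_iff_ball.1 hgood
  have hgH : ∀ q ∈ ball (G a) r, g (Φ.symm q) = L q := fun q hq => by
    rw [← hLG, ← hΦ, Φ.right_inv (hball q hq).1]
  have hderiv : ∀ q ∈ ball (G a) r, HasFDerivAt (f ∘ Φ.symm) (ψ (Φ.symm q) • L) q := by
    intro q hq
    obtain ⟨-, hqU, hqd⟩ := hball q hq
    have hs := (hqd.differentiableAt one_ne_zero).hasFDerivAt
    have h1 := ((hfd _ hqU).differentiableAt one_ne_zero).hasFDerivAt.comp q hs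
    have h2 := ((hgd _ hqU).differentiableAt one_ne_zero).hasFDerivAt.comp q hs
    have h3 : HasFDerivAt (g ∘ Φ.symm) L q :=
      L.hasFDerivAt.congr_of_eventuallyEq (eventually_of_mem (isOpen_ball.mem_nhds hq) hgH)
    rwa [hprop _ hqU, ContinuousLinearMap.smul_comp, h2.unique h3] at h1
  let γ : ℝ → E := fun t => G a + (t - g a) • e
  have hγ : ∀ t, HasDerivAt γ e t := fun t => by
    have h := (((hasDerivAt_id t).sub_const (g a)).smul_const e).const_add (G a)
    rw [one_smul] at h
    exact h
  have hγc : ContDiff ℝ 1 γ :=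
    contDiff_const.add ((contDiff_id.sub contDiff_const).smul contDiff_const)
  have hLγ : ∀ t, L (γ t) = t := fun t => by simp [γ, hLG, he]
  have hγI : ∀ t ∈ ball (g a) (r / ‖e‖), γ t ∈ ball (G a) r := fun t ht => by
    rw [mem_ball, Real.dist_eq, lt_div_iff₀ he0] at ht
    simpa [γ, norm_smul] using ht
  have hnear : ∀ᶠ p in 𝓝 a,
      p ∈ U ∧ p ∈ Φ.source ∧ G p ∈ ball (G a) r ∧ g p ∈ ball (g a) (r / ‖e‖) :=
    Eventually.and (hU.mem_nhds ha) <| Eventually.and (Φ.open_source.mem_nhds haΦ) <|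
      Eventually.and (hG.continuousAt (ball_mem_nhds _ hr))
        ((hgd a ha).continuousAt (ball_mem_nhds _ (div_pos hr he0)))
  obtain ⟨ε, hε, hεp⟩ := Metric.eventually_nhds_iff_ball.1 hnear
  refine ⟨ε, hε, fun p hp => (hεp p hp).1, (f ∘ Φ.symm) ∘ γ, ball (g a) (r / ‖e‖), isOpen_ball,
    (convex_ball _ _).ordConnected, ?_, ?_, ?_, ?_⟩
  · rintro _ ⟨p, hp, rfl⟩
    exact (hεp p hp).2.2.2
  · intro t ht
    obtain ⟨-, hqU, hqd⟩ := hball _ (hγI t ht)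
    exact (((hfd _ hqU).comp _ hqd).comp t hγc.contDiffAt).contDiffWithinAt
  · intro t ht
    have hq := hγI t ht
    rw [((hderiv _ hq).comp_hasDerivAt t (hγ t)).deriv]
    simpa [he] using hψ _ (hball _ hq).2.1
  · intro p hp
    obtain ⟨-, hps, hpG, hpI⟩ := hεp p hp
    obtain ⟨z, -, hz⟩ := domain_mvt (fun q hq => (hderiv q hq).hasFDerivWithinAt)
      (convex_ball (G a) r) (hγI _ hpI) hpG
    have hGp : Φ.symm (G p) = p := Φ.left_inv hps
    simpa [hLγ, hLG, hGp, sub_eq_zero] using hz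

/-- The lemma in the proof of Theorem 5.50: if the gradients of two nondegenerate
C¹ functions `v`, `v'` are pointwise proportional via a nowhere-vanishing
continuous factor `ψ`, then near the origin `v` is a gauge transform of `v'`,
i.e. `v = τ ∘ v'` for a C¹ function `τ` with nowhere-vanishing derivative
defined on an open interval containing the relevant values of `v'`. -/
theorem gauge_transform_of_proportional_gradients
    (U : Set R3) (hU : IsOpen U) (h0 : (0 : R3) ∈ U)
    (v v' : R3 → ℝ) (hv : ContDiffOn ℝ 1 v U) (hv' : ContDiffOn ℝ 1 v' U)
    (hvn : Nondeg v U) (hv'n : Nondeg v' U)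
    (ψ : R3 → ℝ) (hψc : ContinuousOn ψ U) (hψ : ∀ p ∈ U, ψ p ≠ 0)
    (hprop : ∀ p ∈ U,
      pd 0 v p = ψ p * pd 0 v' p ∧
      pd 1 v p = ψ p * pd 1 v' p ∧
      pd 2 v p = ψ p * pd 2 v' p) :
    ∃ ε > 0, Metric.ball (0 : R3) ε ⊆ U ∧
      ∃ (τ : ℝ → ℝ) (I : Set ℝ), IsOpen I ∧ I.OrdConnected ∧
        v' '' Metric.ball (0 : R3) ε ⊆ I ∧
        ContDiffOn ℝ 1 τ I ∧ (∀ t ∈ I, deriv τ t ≠ 0) ∧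
        ∀ p ∈ Metric.ball (0 : R3) ε, v p = τ (v' p) := by
  have hext : ∀ p ∈ U, fderiv ℝ v p = ψ p • fderiv ℝ v' p := by
    intro p hp
    obtain ⟨h1, h2, h3⟩ := hprop p hp
    refine ContinuousLinearMap.coe_injective
      ((EuclideanSpace.basisFun (Fin 3) ℝ).toBasis.ext fun i => ?_)
    fin_cases i
    · simpa [pd] using h1
    · simpa [pd] using h2
    · simpa [pd] using h3
  refine exists_eq_comp_of_fderiv_eq_smul hU h0 hv hv' (fun h => ?_) hψ hext
  exact (hv'n 0 h0).1 (by simp [pd, h])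
end
end

section
/- Let (A,B,C) and (Ã,B̃,C̃) be admissible triples of real numbers, and let w, v, v′ be C¹ nondegenerate functions on an open neighborhood U of the origin in ℝ³ such that both pairs (w,v) and (w,v′) satisfy the Bäcklund system on U. Then there exist ε > 0 with B_ε(0) ⊆ U and a C¹ function τ, defined on an open interval containing v′(B_ε(0)) and having nowhere-vanishing derivative, such that v = τ∘v′ on B_ε(0). (Theorem 5.50, part 5: the Bäcklund partner is unique up to a gauge transform.) -/
noncomputable section

open Filter Topology

/-- If the differential of `f` is a nowhere-vanishing multiple of the differential of the submersion
`g` near `x₀`, then near `x₀` the function `f` is a `C¹` reparametrisation of `g`. -/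
theorem exists_comp_eq_of_fderiv_eq_smul {E : Type*} [NormedAddCommGroup E] [NormedSpace ℝ E]
    [CompleteSpace E] {f g : E → ℝ} {a : E → ℝ} {x₀ : E}
    (hf : ContDiffAt ℝ 1 f x₀) (hg : ContDiffAt ℝ 1 g x₀) (hg0 : fderiv ℝ g x₀ ≠ 0)
    (hfg : ∀ᶠ p in 𝓝 x₀, fderiv ℝ f p = a p • fderiv ℝ g p ∧ a p ≠ 0) :
    ∃ (τ : ℝ → ℝ) (I : Set ℝ), IsOpen I ∧ I.OrdConnected ∧ ContDiffOn ℝ 1 τ I ∧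
      (∀ t ∈ I, deriv τ t ≠ 0) ∧ ∀ᶠ p in 𝓝 x₀, g p ∈ I ∧ f p = τ (g p) := by
  set l := fderiv ℝ g x₀ with hl
  obtain ⟨e, he⟩ : ∃ e, l e = 1 := by
    obtain ⟨u, hu⟩ : ∃ u, l u ≠ 0 := by
      by_contra! h
      exact hg0 (ContinuousLinearMap.ext h)
    exact ⟨(l u)⁻¹ • u, by simp [hu]⟩
  -- A local diffeomorphism that carries `g` to the linear functional `l`.
  let Φ : E → E := fun p => p + (g p - l p) • e
  have hΦ : ContDiffAt ℝ 1 Φ x₀ :=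
    contDiffAt_id.add ((hg.sub l.contDiff.contDiffAt).smul contDiffAt_const)
  have hΦ' : HasFDerivAt Φ ((ContinuousLinearEquiv.refl ℝ E : E ≃L[ℝ] E) : E →L[ℝ] E) x₀ := by
    have hg' : HasFDerivAt g l x₀ := (hg.differentiableAt one_ne_zero).hasFDerivAt
    have h := (hasFDerivAt_id (𝕜 := ℝ) x₀).add ((hg'.sub l.hasFDerivAt).smul_const e)
    refine h.congr_fderiv ?_
    ext u
    simp
  have hlΦ (p : E) : l (Φ p) = g p := by simp [Φ, he]
  let P := hΦ.toOpenPartialHomeomorph Φ hΦ' one_ne_zero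
  have hPΦ (p : E) : P p = Φ p := rfl
  have hx₀ : x₀ ∈ P.source := hΦ.mem_toOpenPartialHomeomorph_source hΦ' one_ne_zero
  have hc : Φ x₀ ∈ P.target := P.map_source hx₀
  have hΨc : P.symm (Φ x₀) = x₀ := P.left_inv hx₀
  have hΨ : ContDiffAt ℝ 1 P.symm (Φ x₀) := hΦ.to_localInverse hΦ' one_ne_zero
  have htend : Tendsto P.symm (𝓝 (Φ x₀)) (𝓝 x₀) := by
    simpa only [ContinuousAt, hΨc] using hΨ.continuousAt
  have hev : ∀ᶠ q in 𝓝 (Φ x₀), q ∈ P.target ∧ ContDiffAt ℝ 1 P.symm q ∧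
      ContDiffAt ℝ 1 f (P.symm q) ∧ ContDiffAt ℝ 1 g (P.symm q) ∧
      fderiv ℝ f (P.symm q) = a (P.symm q) • fderiv ℝ g (P.symm q) ∧ a (P.symm q) ≠ 0 :=
    Filter.Eventually.and (P.open_target.mem_nhds hc) <| (hΨ.eventually (by simp)).and <|
      (htend.eventually (hf.eventually (by simp))).and <|
      (htend.eventually (hg.eventually (by simp))).and <| htend.eventually hfg
  obtain ⟨r, hr, hball⟩ := Metric.eventually_nhds_iff_ball.1 hev
  have hgΨ : ∀ q ∈ Metric.ball (Φ x₀) r, g (P.symm q) = l q := fun q hq => by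
    rw [← hlΦ, ← hPΦ, P.right_inv (hball q hq).1]
  have hder : ∀ q ∈ Metric.ball (Φ x₀) r,
      HasFDerivAt (f ∘ P.symm) (a (P.symm q) • l) q := fun q hq => by
    obtain ⟨-, hs, hfq, hgq, hfgq, -⟩ := hball q hq
    have hs' := (hs.differentiableAt one_ne_zero).hasFDerivAt
    have h1 := (hfq.differentiableAt one_ne_zero).hasFDerivAt.comp q hs'
    have h2 := (hgq.differentiableAt one_ne_zero).hasFDerivAt.comp q hs'
    have h3 : HasFDerivAt (g ∘ P.symm) l q := l.hasFDerivAt.congr_of_eventuallyEq <|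
      Filter.mem_of_superset (Metric.isOpen_ball.mem_nhds hq) hgΨ
    rw [← h2.unique h3, ← ContinuousLinearMap.smul_comp, ← hfgq]
    exact h1
  let γ : ℝ → E := fun t => Φ x₀ + (t - l (Φ x₀)) • e
  have hγ : ContDiff ℝ 1 γ :=
    contDiff_const.add ((contDiff_id.sub contDiff_const).smul contDiff_const)
  have hγ' (t : ℝ) : HasDerivAt γ e t := by
    simpa only [one_smul] using
      (((hasDerivAt_id' t).sub_const (l (Φ x₀))).smul_const e).const_add (Φ x₀)
  have hlγ (t : ℝ) : l (γ t) = t := by simp [γ, he]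
  have hγc : γ (g x₀) = Φ x₀ := by simp [γ, hlΦ]
  obtain ⟨δ, hδ, hI⟩ : ∃ δ > 0, ∀ t ∈ Metric.ball (g x₀) δ, γ t ∈ Metric.ball (Φ x₀) r := by
    refine Metric.eventually_nhds_iff_ball.1 (hγ.continuous.continuousAt.eventually_mem ?_)
    rw [hγc]
    exact Metric.ball_mem_nhds _ hr
  refine ⟨f ∘ P.symm ∘ γ, Metric.ball (g x₀) δ, Metric.isOpen_ball,
    (convex_ball _ _).ordConnected, fun t ht => ?_, fun t ht => ?_, ?_⟩
  · obtain ⟨-, hs, hfq, -⟩ := hball _ (hI t ht)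
    exact (hfq.comp t (hs.comp t hγ.contDiffAt)).contDiffWithinAt
  · have h := (hder _ (hI t ht)).comp_hasDerivAt t (hγ' t)
    rw [show f ∘ P.symm ∘ γ = (f ∘ P.symm) ∘ γ from rfl, h.deriv]
    simpa [he] using (hball _ (hI t ht)).2.2.2.2.2
  · filter_upwards [P.open_source.mem_nhds hx₀, hg.continuousAt (Metric.ball_mem_nhds _ hδ),
      hΦ.continuousAt (Metric.ball_mem_nhds _ hr)] with p hp hpI hpr
    refine ⟨hpI, ?_⟩
    have hconst : (f ∘ P.symm) (Φ p) = (f ∘ P.symm) (γ (g p)) := by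
      obtain ⟨z, hz, hzeq⟩ := domain_mvt
        (fun q hq => (hder q hq).hasFDerivWithinAt) (convex_ball (Φ x₀) r) (hI _ hpI) hpr
      have : l (Φ p - γ (g p)) = 0 := by rw [map_sub, hlΦ, hlγ, sub_self]
      rw [smul_apply, this, smul_zero] at hzeq
      exact sub_eq_zero.1 hzeq
    have hleft : P.symm (Φ p) = p := P.left_inv hp
    simpa [hleft] using hconst

/-- Two nondegenerate solutions of the same Bäcklund system have proportional differentials. -/
theorem Backlund.fderiv_eq_smul {A B C A' B' C' : ℝ} {w v v' : R3 → ℝ} {U : Set R3}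
    (hA : A ≠ 0) (hB₀ : B' ≠ 0) (hC₀ : C' ≠ 0) (hwn : Nondeg w U) (hv'n : Nondeg v' U)
    (hB : Backlund A B C A' B' C' w v U) (hB' : Backlund A B C A' B' C' w v' U)
    {p : R3} (hp : p ∈ U) :
    fderiv ℝ v p = (pd 0 v p / pd 0 v' p) • fderiv ℝ v' p := by
  have hw0 := (hwn p hp).1
  have hv'0 := (hv'n p hp).1
  obtain ⟨h1, h2⟩ := hB p hp
  obtain ⟨h1', h2'⟩ := hB' p hp
  have key1 : pd 1 v p = pd 0 v p / pd 0 v' p * pd 1 v' p := by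
    field_simp
    refine mul_left_cancel₀ (mul_ne_zero (mul_ne_zero hA hB₀) hw0) ?_
    linear_combination pd 0 v' p * h1 - pd 0 v p * h1'
  have key2 : pd 2 v p = pd 0 v p / pd 0 v' p * pd 2 v' p := by
    field_simp
    refine mul_left_cancel₀ (mul_ne_zero (mul_ne_zero hA hC₀) hw0) ?_
    linear_combination pd 0 v' p * h2 - pd 0 v p * h2'
  have key0 : pd 0 v p = pd 0 v p / pd 0 v' p * pd 0 v' p := by field_simp
  refine ContinuousLinearMap.coe_injective
    ((EuclideanSpace.basisFun (Fin 3) ℝ).toBasis.ext fun i => ?_)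
  fin_cases i
  · simpa [pd] using key0
  · simpa [pd] using key1
  · simpa [pd] using key2

/-- Theorem 5.50, part 5: the Bäcklund partner of `w` is unique up to a gauge
transform near the origin. -/
theorem backlund_partner_unique_up_to_gauge
    (A B C A' B' C' : ℝ) (hABC : Admissible A B C) (hABC' : Admissible A' B' C')
    (U : Set R3) (hU : IsOpen U) (h0 : (0 : R3) ∈ U)
    (w v v' : R3 → ℝ)
    (hw : ContDiffOn ℝ 1 w U) (hv : ContDiffOn ℝ 1 v U) (hv' : ContDiffOn ℝ 1 v' U)
    (hwn : Nondeg w U) (hvn : Nondeg v U) (hv'n : Nondeg v' U)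
    (hB : Backlund A B C A' B' C' w v U)
    (hB' : Backlund A B C A' B' C' w v' U) :
    ∃ ε > 0, Metric.ball (0 : R3) ε ⊆ U ∧
      ∃ (τ : ℝ → ℝ) (I : Set ℝ), IsOpen I ∧ I.OrdConnected ∧
        v' '' Metric.ball (0 : R3) ε ⊆ I ∧
        ContDiffOn ℝ 1 τ I ∧ (∀ t ∈ I, deriv τ t ≠ 0) ∧
        ∀ p ∈ Metric.ball (0 : R3) ε, v p = τ (v' p) := by
  have hUn : U ∈ 𝓝 (0 : R3) := hU.mem_nhds h0
  have hne : fderiv ℝ v' 0 ≠ 0 := fun h => (hv'n 0 h0).1 (by simp [pd, h])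
  obtain ⟨τ, I, hI, hIc, hτ, hτ', hev⟩ := exists_comp_eq_of_fderiv_eq_smul
    (hv.contDiffAt hUn) (hv'.contDiffAt hUn) hne
    (Filter.mem_of_superset hUn fun p hp =>
      ⟨Backlund.fderiv_eq_smul hABC.1 hABC'.2.1 hABC'.2.2.1 hwn hv'n hB hB' hp,
        div_ne_zero (hvn p hp).1 (hv'n p hp).1⟩)
  obtain ⟨ε, hε, hball⟩ := Metric.eventually_nhds_iff_ball.1 (hev.and hUn)
  exact ⟨ε, hε, fun p hp => (hball p hp).2, τ, I, hI, hIc,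
    Set.image_subset_iff.2 fun p hp => (hball p hp).1.1, hτ, hτ',
    fun p hp => (hball p hp).1.2⟩
end
end

section
/- Let v₁, v₂, v₃ ∈ ℂ³ be linearly independent, let v₄ ∈ ℂ³ be arbitrary, and let λ₁, λ₂, λ₃, λ₄ ∈ ℂ be pairwise distinct. Then there exists a unique map v : ℂ → ℂ³ whose three component functions are given by polynomials of degree at most 2, such that v(λ₄) = v₄ and, for each k ∈ {1,2,3}, v(λ_k) is a scalar multiple of v_k. (Lemma 4.45.) -/
/-- A map `ℂ → ℂ³` has polynomial components of degree at most 2. -/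
def PolyComponentsDeg2 (f : ℂ → Fin 3 → ℂ) : Prop :=
  ∃ P : Fin 3 → Polynomial ℂ, (∀ i, (P i).degree ≤ 2) ∧ ∀ x i, f x i = (P i).eval x

/-- A polynomial map `ℂ → ℂ³` of degree at most 2 is recovered from its values at three nodes by
Lagrange interpolation. -/
theorem PolyComponentsDeg2.eq_sum_basis {f : ℂ → Fin 3 → ℂ} (hf : PolyComponentsDeg2 f)
    {m : Fin 3 → ℂ} (hm : Function.Injective m) (x : ℂ) :
    f x = ∑ k, (Lagrange.basis Finset.univ m k).eval x • f (m k) := by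
  obtain ⟨P, hdeg, hP⟩ := hf
  ext i
  have hlt : (P i).degree < (Finset.univ : Finset (Fin 3)).card :=
    (hdeg i).trans_lt (by rw [Finset.card_fin]; exact_mod_cast Nat.lt_succ_self 2)
  rw [hP x i, Lagrange.eq_interpolate hm.injOn hlt, Lagrange.interpolate_apply,
    Polynomial.eval_finsetSum]
  simp [hP, mul_comm]

/-- Any combination of the Lagrange basis on three nodes with vector coefficients has polynomial
components of degree at most 2. -/
theorem polyComponentsDeg2_sum_basis {m : Fin 3 → ℂ} (hm : Function.Injective m)
    (w : Fin 3 → Fin 3 → ℂ) :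
    PolyComponentsDeg2 fun x => ∑ k, (Lagrange.basis Finset.univ m k).eval x • w k := by
  refine ⟨fun i => ∑ k, Lagrange.basis Finset.univ m k * Polynomial.C (w k i), fun i => ?_,
    fun x i => by simp [Polynomial.eval_finsetSum]⟩
  refine (Polynomial.degree_sum_le _ _).trans (Finset.sup_le fun k _ => ?_)
  refine (Polynomial.degree_mul_le _ _).trans ?_
  rw [Lagrange.degree_basis hm.injOn (Finset.mem_univ k)]
  exact (add_le_add_right Polynomial.degree_C_le _).trans (by simp)

/-- A Lagrange basis polynomial does not vanish outside the set of nodes. -/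
theorem eval_lagrangeBasis_ne_zero {F ι : Type*} [Field F] [DecidableEq ι] {s : Finset ι}
    {m : ι → F} (hm : Set.InjOn m s) {k : ι} (hk : k ∈ s) {x : F} (hx : ∀ i ∈ s, x ≠ m i) :
    (Lagrange.basis s m k).eval x ≠ 0 := by
  rw [Lagrange.basis, Polynomial.eval_prod, Finset.prod_ne_zero_iff]
  intro j hj
  obtain ⟨hjk, hjs⟩ := Finset.mem_erase.mp hj
  have hkj : m k - m j ≠ 0 := sub_ne_zero.mpr fun h => hjk (hm hk hjs h).symm
  simp [Lagrange.basisDivisor, hkj, sub_ne_zero.mpr (hx j hjs)]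

/-- The Lagrange basis combination takes the prescribed value at each node. -/
theorem sum_eval_lagrangeBasis_smul {m : Fin 3 → ℂ} (hm : Function.Injective m)
    (w : Fin 3 → Fin 3 → ℂ) (j : Fin 3) :
    ∑ k, (Lagrange.basis Finset.univ m k).eval (m j) • w k = w j := by
  rw [Finset.sum_eq_single j]
  · rw [Lagrange.eval_basis_self hm.injOn (Finset.mem_univ j), one_smul]
  · intro k _ hkj
    rw [Lagrange.eval_basis_of_ne hkj (Finset.mem_univ j), zero_smul]
  · simp

/-- Lemma 4.45: given linearly independent `v₁, v₂, v₃ ∈ ℂ³`, an arbitrary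
`v₄ ∈ ℂ³`, and pairwise distinct `λ₁, λ₂, λ₃, λ₄ ∈ ℂ`, there is a unique map
`v : ℂ → ℂ³` with polynomial components of degree ≤ 2 such that `v(λ₄) = v₄`
and `v(λₖ)` is a scalar multiple of `vₖ` for `k = 1, 2, 3`. -/
theorem unique_quadratic_vector_function
    (v : Fin 3 → Fin 3 → ℂ) (hv : LinearIndependent ℂ v)
    (v₄ : Fin 3 → ℂ)
    (l : Fin 4 → ℂ) (hl : Function.Injective l) :
    ∃! f : ℂ → Fin 3 → ℂ,
      PolyComponentsDeg2 f ∧ f (l 3) = v₄ ∧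
        ∀ k : Fin 3, ∃ c : ℂ, f (l k.castSucc) = c • v k := by
  set m : Fin 3 → ℂ := fun k => l k.castSucc
  have hm : Function.Injective m := hl.comp (Fin.castSucc_injective 3)
  have hL (k : Fin 3) : (Lagrange.basis Finset.univ m k).eval (l 3) ≠ 0 :=
    eval_lagrangeBasis_ne_zero hm.injOn (Finset.mem_univ k)
      fun i _ h => (Fin.castSucc_lt_last i).ne' (hl h)
  let b := basisOfLinearIndependentOfCardEqFinrank hv (by simp)
  have hb : ∑ k, b.repr v₄ k • v k = v₄ := by
    simpa [b] using b.sum_repr v₄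
  let c (k : Fin 3) : ℂ := ((Lagrange.basis Finset.univ m k).eval (l 3))⁻¹ * b.repr v₄ k
  refine ⟨fun x => ∑ k, (Lagrange.basis Finset.univ m k).eval x • c k • v k,
    ⟨polyComponentsDeg2_sum_basis hm _, ?_,
      fun k => ⟨c k, sum_eval_lagrangeBasis_smul hm (fun k => c k • v k) k⟩⟩, ?_⟩
  · simpa only [c, smul_smul, mul_inv_cancel_left₀ (hL _)] using hb
  · rintro g ⟨hg, hg₄, hgv⟩
    choose d hd using hgv
    have hgd (x : ℂ) : g x = ∑ k, (Lagrange.basis Finset.univ m k).eval x • d k • v k := by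
      rw [hg.eq_sum_basis hm x]
      exact Finset.sum_congr rfl fun k _ => by rw [← hd k]
    have hcoeff : ∑ k, ((Lagrange.basis Finset.univ m k).eval (l 3) * d k) • v k =
        ∑ k, b.repr v₄ k • v k := by
      rw [hb, ← hg₄, hgd]
      simp only [smul_smul]
    have hdc (k : Fin 3) : d k = c k := by
      rw [eq_inv_mul_iff_mul_eq₀ (hL k)]
      exact congrFun (hv.fintypeLinearCombination_injective
        (by simpa [Fintype.linearCombination_apply] using hcoeff)) k
    ext1 x
    simp only [hgd x, hdc]
end

section
/- (Uniqueness) Let p, q : ℂ → ℂ³ be maps whose three component functions are polynomials of degree at most 2, and suppose the three component polynomials of p are linearly independent over ℂ, and likewise for q. Let λ₁, λ₂, λ₃, λ₄ ∈ ℂ be pairwise distinct and suppose for each i ∈ {1,2,3,4} there is cᵢ ≠ 0 with p(λᵢ) = cᵢ·q(λᵢ). Then there is a single c ≠ 0 with p(λ) = c·q(λ) for all λ ∈ ℂ. (Existence) Given pairwise distinct λ₁, λ₂, λ₃, λ₄ ∈ ℂ and nonzero vectors P₁, P₂, P₃, P₄ ∈ ℂ³ such that any three of them are linearly independent, there exist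 a map p : ℂ → ℂ³ with polynomial components of degree at most 2 whose component polynomials are linearly independent, and nonzero scalars c₁, c₂, c₃, c₄ with p(λᵢ) = cᵢ·Pᵢ for i = 1,…,4. (Lemma 3.10, in affine coordinates: a parameterized quadric in the projective plane is uniquely determined by, and can be prescribed by, its values at 4 parameter values.) -/
/-- `f : ℂ → ℂ³` parameterizes a quadric via the polynomials `P`: its components
are given by polynomials of degree ≤ 2 that are linearly independent. -/
def IsQuadricParam (f : ℂ → Fin 3 → ℂ) (P : Fin 3 → Polynomial ℂ) : Prop :=
  (∀ i, (P i).degree ≤ 2) ∧ (∀ x i, f x i = (P i).eval x) ∧ LinearIndependent ℂ P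

open Polynomial in
/-- Evaluation at `n` distinct nodes turns `n` polynomials of degree `< n` into a square matrix
whose rows are linearly independent exactly when the polynomials are. -/
theorem linearIndependent_eval_nodes_iff {K : Type*} [Field K] {n : ℕ} {v : Fin n → K}
    (hv : Function.Injective v) {Q : Fin n → K[X]} (hQ : ∀ k, (Q k).degree < n) :
    LinearIndependent K (fun i k => (Q k).eval (v i)) ↔ LinearIndependent K Q := by
  have hcols : LinearIndependent K (fun i k => (Q k).eval (v i)) ↔
      LinearIndependent K (fun k i => (Q k).eval (v i)) :=
    (Matrix.linearIndependent_rows_iff_isUnit (A := .of fun i k => (Q k).eval (v i))).trans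
      Matrix.linearIndependent_cols_iff_isUnit.symm
  rw [hcols]
  refine LinearMap.linearIndependent_iff_of_injOn (LinearMap.pi fun i => leval (v i)) ?_
  have hspan : Submodule.span K (Set.range Q) ≤ degreeLT K n := by
    rw [Submodule.span_le]
    rintro _ ⟨k, rfl⟩
    exact mem_degreeLT.2 (hQ k)
  intro f hf g hg hfg
  refine eq_of_degrees_lt_of_eval_index_eq Finset.univ hv.injOn ?_ ?_ fun i _ => congrFun hfg i
  · simpa using mem_degreeLT.1 (hspan hf)
  · simpa using mem_degreeLT.1 (hspan hg)

open Polynomial in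
/-- The value at `x` of a polynomial of degree `< n` in terms of its values at `n` nodes. -/
theorem eval_eq_sum_lagrange_basis {K : Type*} [Field K] {n : ℕ} {v : Fin n → K}
    (hv : Function.Injective v) {f : K[X]} (hf : f.degree < n) (x : K) :
    f.eval x = ∑ i, (Lagrange.basis Finset.univ v i).eval x * f.eval (v i) := by
  conv_lhs => rw [Lagrange.eq_interpolate (f := f) (s := Finset.univ) hv.injOn (by simpa using hf)]
  simp [Lagrange.interpolate_apply, eval_finsetSum, mul_comm]

open Polynomial in
theorem eval_lagrange_basis_ne_zero {K ι : Type*} [Field K] [DecidableEq ι] {s : Finset ι}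
    {v : ι → K} (hv : Set.InjOn v s) {i : ι} (hi : i ∈ s) {x : K} (hx : ∀ j ∈ s, x ≠ v j) :
    (Lagrange.basis s v i).eval x ≠ 0 := by
  rw [Lagrange.basis, eval_prod, Finset.prod_ne_zero_iff]
  intro j hj
  obtain ⟨hji, hj⟩ := Finset.mem_erase.1 hj
  have h : v i - v j ≠ 0 := sub_ne_zero.2 fun h => hji (hv hi hj h).symm
  simp [Lagrange.basisDivisor, h, sub_ne_zero.2 (hx j hj)]

theorem IsQuadricParam.degree_lt {f : ℂ → Fin 3 → ℂ} {P : Fin 3 → Polynomial ℂ}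
    (h : IsQuadricParam f P) (k : Fin 3) : (P k).degree < (3 : ℕ) :=
  (h.1 k).trans_lt (by norm_cast)

/-- A parameterized quadric takes linearly independent values at three distinct parameters. -/
theorem IsQuadricParam.linearIndependent {f : ℂ → Fin 3 → ℂ} {P : Fin 3 → Polynomial ℂ}
    (h : IsQuadricParam f P) {v : Fin 3 → ℂ} (hv : Function.Injective v) :
    LinearIndependent ℂ (fun i => f (v i)) := by
  have hf : (fun i => f (v i)) = fun i k => (P k).eval (v i) := by
    ext i k
    exact h.2.1 _ _
  rw [hf]
  exact (linearIndependent_eval_nodes_iff hv h.degree_lt).2 h.2.2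

theorem IsQuadricParam.eq_sum_lagrange_basis {f : ℂ → Fin 3 → ℂ} {P : Fin 3 → Polynomial ℂ}
    (h : IsQuadricParam f P) {v : Fin 3 → ℂ} (hv : Function.Injective v) (x : ℂ) :
    f x = ∑ i, (Lagrange.basis Finset.univ v i).eval x • f (v i) := by
  ext k
  simp only [Finset.sum_apply, Pi.smul_apply, smul_eq_mul, h.2.1]
  exact eval_eq_sum_lagrange_basis hv (h.degree_lt k) x

theorem IsQuadricParam.exists_eq_smul {p q : ℂ → Fin 3 → ℂ} {P Q : Fin 3 → Polynomial ℂ}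
    (hp : IsQuadricParam p P) (hq : IsQuadricParam q Q) {l : Fin 4 → ℂ}
    (hl : Function.Injective l) (h : ∀ i, ∃ c : ℂ, c ≠ 0 ∧ p (l i) = c • q (l i)) :
    ∃ c : ℂ, c ≠ 0 ∧ ∀ x, p x = c • q x := by
  choose c hc hpq using h
  have hv : Function.Injective fun i : Fin 3 => l i.castSucc :=
    hl.comp (Fin.castSucc_injective 3)
  have hzero : ∑ i : Fin 3, ((Lagrange.basis Finset.univ (fun i : Fin 3 => l i.castSucc) i).eval
      (l (Fin.last 3)) * (c i.castSucc - c (Fin.last 3))) • q (l i.castSucc) = 0 := by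
    have h₁ := hpq (Fin.last 3)
    rw [hp.eq_sum_lagrange_basis hv, hq.eq_sum_lagrange_basis hv, Finset.smul_sum,
      ← sub_eq_zero, ← Finset.sum_sub_distrib] at h₁
    rw [← h₁]
    refine Finset.sum_congr rfl fun i _ => ?_
    rw [hpq]
    module
  have hconst (i : Fin 3) : c i.castSucc = c (Fin.last 3) := by
    have h₁ := Fintype.linearIndependent_iff.1 (hq.linearIndependent hv) _ hzero i
    refine sub_eq_zero.1 ((mul_eq_zero.1 h₁).resolve_left ?_)
    exact eval_lagrange_basis_ne_zero hv.injOn (Finset.mem_univ i)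
      fun j _ => hl.ne (Fin.castSucc_lt_last j).ne'
  refine ⟨c (Fin.last 3), hc _, fun x => ?_⟩
  rw [hp.eq_sum_lagrange_basis hv, hq.eq_sum_lagrange_basis hv, Finset.smul_sum]
  refine Finset.sum_congr rfl fun i _ => ?_
  rw [hpq, hconst, smul_comm]

/-- A vector in general position with respect to three vectors of a three-dimensional space is
a combination of these with nonzero coefficients. -/
theorem exists_last_eq_sum_smul {K : Type*} [Field K] {w : Fin 4 → Fin 3 → K}
    (hw : ∀ i j k : Fin 4, i ≠ j → i ≠ k → j ≠ k → LinearIndependent K ![w i, w j, w k]) :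
    ∃ a : Fin 3 → K, (∀ i, a i ≠ 0) ∧ w (Fin.last 3) = ∑ i, a i • w i.castSucc := by
  have hspan := (hw 0 1 2 (by decide) (by decide) (by decide)).span_eq_top_of_card_eq_finrank'
    (by simp)
  obtain ⟨a, ha⟩ := (Submodule.mem_span_range_iff_exists_fun K).1
    (hspan ▸ Submodule.mem_top : w 3 ∈ Submodule.span K (Set.range ![w 0, w 1, w 2]))
  have ha' : a 0 • w 0 + a 1 • w 1 + a 2 • w 2 = w 3 := by
    simpa [Fin.sum_univ_three] using ha
  have hne {j k : Fin 4} (hjk : j ≠ k) (hj : j ≠ 3) (hk : k ≠ 3) (b c : K) :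
      b • w j + c • w k ≠ w 3 := by
    intro h
    have h₁ := Fintype.linearIndependent_iff.1 (hw j k 3 hjk hj hk) ![b, c, -1]
      (by simp [Fin.sum_univ_three, h]) 2
    simp at h₁
  refine ⟨a, fun i hi => ?_, ?_⟩
  · fin_cases i
    · exact hne (j := 1) (k := 2) (by decide) (by decide) (by decide) (a 1) (a 2)
        (by simpa [show a 0 = 0 from hi] using ha')
    · exact hne (j := 0) (k := 2) (by decide) (by decide) (by decide) (a 0) (a 2)
        (by simpa [show a 1 = 0 from hi] using ha')
    · exact hne (j := 0) (k := 1) (by decide) (by decide) (by decide) (a 0) (a 1)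
        (by simpa [show a 2 = 0 from hi] using ha')
  · rw [Fin.sum_univ_three]
    exact ha'.symm

/-- There is a parameterized quadric with prescribed linearly independent values at three
distinct parameters. -/
theorem exists_isQuadricParam_of_linearIndependent {v : Fin 3 → ℂ} (hv : Function.Injective v)
    {w : Fin 3 → Fin 3 → ℂ} (hw : LinearIndependent ℂ w) :
    ∃ (p : ℂ → Fin 3 → ℂ) (P : Fin 3 → Polynomial ℂ), IsQuadricParam p P ∧
      ∀ i, p (v i) = w i := by
  let P (k : Fin 3) : Polynomial ℂ := Lagrange.interpolate Finset.univ v fun i => w i k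
  have heval (i k : Fin 3) : (P k).eval (v i) = w i k :=
    Lagrange.eval_interpolate_at_node _ hv.injOn (Finset.mem_univ i)
  have hdeg (k : Fin 3) : (P k).degree ≤ 2 :=
    Lagrange.degree_interpolate_le _ hv.injOn
  have hdeg_lt (k : Fin 3) : (P k).degree < (3 : ℕ) := (hdeg k).trans_lt (by norm_cast)
  refine ⟨fun x k => (P k).eval x, P, ⟨hdeg, fun _ _ => rfl, ?_⟩, fun i => funext (heval i)⟩
  rw [← linearIndependent_eval_nodes_iff hv hdeg_lt]
  simpa only [heval] using hw

theorem exists_isQuadricParam_through {l : Fin 4 → ℂ} (hl : Function.Injective l)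
    {w : Fin 4 → Fin 3 → ℂ}
    (hw : ∀ i j k : Fin 4, i ≠ j → i ≠ k → j ≠ k → LinearIndependent ℂ ![w i, w j, w k]) :
    ∃ (p : ℂ → Fin 3 → ℂ) (P : Fin 3 → Polynomial ℂ), IsQuadricParam p P ∧
      ∀ i, ∃ c : ℂ, c ≠ 0 ∧ p (l i) = c • w i := by
  obtain ⟨a, ha, hlast⟩ := exists_last_eq_sum_smul hw
  have hv : Function.Injective fun i : Fin 3 => l i.castSucc :=
    hl.comp (Fin.castSucc_injective 3)
  let u (i : Fin 3) : ℂ :=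
    (Lagrange.basis Finset.univ (fun i : Fin 3 => l i.castSucc) i).eval (l (Fin.last 3))
  have hu (i : Fin 3) : u i ≠ 0 :=
    eval_lagrange_basis_ne_zero hv.injOn (Finset.mem_univ i)
      fun j _ => hl.ne (Fin.castSucc_lt_last j).ne'
  have hind : LinearIndependent ℂ fun i : Fin 3 => w i.castSucc := by
    convert hw 0 1 2 (by decide) (by decide) (by decide) using 1
    ext i
    fin_cases i <;> rfl
  have hind' : LinearIndependent ℂ fun i : Fin 3 => (a i / u i) • w i.castSucc :=
    hind.units_smul fun i => Units.mk0 (a i / u i) (div_ne_zero (ha i) (hu i))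
  obtain ⟨p, P, hP, hval⟩ := exists_isQuadricParam_of_linearIndependent hv hind'
  refine ⟨p, P, hP, Fin.lastCases ⟨1, one_ne_zero, ?_⟩ fun i =>
    ⟨a i / u i, div_ne_zero (ha i) (hu i), hval i⟩⟩
  rw [hP.eq_sum_lagrange_basis hv, hlast, one_smul]
  refine Finset.sum_congr rfl fun i _ => ?_
  rw [hval, smul_smul]
  exact congrArg (· • _) (mul_div_cancel₀ (a i) (hu i))

/-- Lemma 3.10 in affine coordinates.
Uniqueness: two parameterized quadrics whose values at 4 distinct parameter
values are proportional (by nonzero scalars) are globally proportional by a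
single nonzero scalar.
Existence: given 4 points in ℂ³, any three of which are linearly independent,
there is a parameterized quadric passing through them (projectively) at any 4
prescribed distinct parameter values. -/
theorem quadric_through_four_points :
    (∀ (p q : ℂ → Fin 3 → ℂ) (P Q : Fin 3 → Polynomial ℂ),
      IsQuadricParam p P → IsQuadricParam q Q →
      ∀ l : Fin 4 → ℂ, Function.Injective l →
      (∀ i : Fin 4, ∃ c : ℂ, c ≠ 0 ∧ p (l i) = c • q (l i)) →
      ∃ c : ℂ, c ≠ 0 ∧ ∀ x : ℂ, p x = c • q x) ∧
    (∀ (l : Fin 4 → ℂ), Function.Injective l →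
      ∀ (Pt : Fin 4 → Fin 3 → ℂ), (∀ i, Pt i ≠ 0) →
      (∀ i j k : Fin 4, i ≠ j → i ≠ k → j ≠ k →
        LinearIndependent ℂ ![Pt i, Pt j, Pt k]) →
      ∃ (p : ℂ → Fin 3 → ℂ) (P : Fin 3 → Polynomial ℂ),
        IsQuadricParam p P ∧
        ∀ i : Fin 4, ∃ c : ℂ, c ≠ 0 ∧ p (l i) = c • Pt i) := by
  exact ⟨fun _ _ _ _ hp hq _ hl h => hp.exists_eq_smul hq hl h,
    fun _ hl _ _ hw => exists_isQuadricParam_through hl hw⟩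
end

section
/- Let (A,B,C) and (Ã,B̃,C̃) be admissible triples of real numbers, U ⊆ ℝ³ open, and let (w,v) be a pair of C¹ nondegenerate functions satisfying the Bäcklund system on U. Then: (i) there is a nowhere-vanishing function c : U → ℝ such that Ã·v_x = c·A·w_x, B̃·v_y = c·B·w_y and C̃·v_z = c·C·w_z at every point of U — consequently, at each point the quadratic forms Λ₁(ξ,η,ζ) = A·w_x·ηζ + B·w_y·ξζ + C·w_z·ξη and Λ₂(ξ,η,ζ) = Ã·v_x·ηζ + B̃·v_y·ξζ + C̃·v_z·ξη are proportional by a nonzero factor, so their zero sets (characteristic cones) coincide; and (ii) A·w_x·v_y·v_z + B·w_y·v_x·v_z + C·w_z·v_x·v_y = 0 on U, i.e. v is a solution of the eikonal equation for the linearization of the (A,B,C)-equation at w. (The Proposition of Section 6.) -/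
noncomputable section

/-- The Proposition of Section 6: for a solution `(w,v)` of the Bäcklund system,
the gradients are proportional so the characteristic cones of both linearized
equations coincide, and `v` solves the eikonal equation for the linearization
of the (A,B,C)-equation at `w`. -/
theorem backlund_characteristic_cones_and_eikonal
    (A B C A' B' C' : ℝ) (hABC : Admissible A B C) (hABC' : Admissible A' B' C')
    (U : Set R3) (hU : IsOpen U)
    (w v : R3 → ℝ) (hw : ContDiffOn ℝ 1 w U) (hv : ContDiffOn ℝ 1 v U)
    (hwn : Nondeg w U) (hvn : Nondeg v U)
    (hB : Backlund A B C A' B' C' w v U) :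
    (∃ c : R3 → ℝ, (∀ p ∈ U, c p ≠ 0) ∧
      ∀ p ∈ U,
        A' * pd 0 v p = c p * (A * pd 0 w p) ∧
        B' * pd 1 v p = c p * (B * pd 1 w p) ∧
        C' * pd 2 v p = c p * (C * pd 2 w p)) ∧
    (∀ p ∈ U, ∀ ξ η ζ : ℝ,
      A * pd 0 w p * (η * ζ) + B * pd 1 w p * (ξ * ζ) + C * pd 2 w p * (ξ * η) = 0 ↔
      A' * pd 0 v p * (η * ζ) + B' * pd 1 v p * (ξ * ζ) + C' * pd 2 v p * (ξ * η) = 0) ∧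
    (∀ p ∈ U,
      A * pd 0 w p * (pd 1 v p * pd 2 v p) + B * pd 1 w p * (pd 0 v p * pd 2 v p)
        + C * pd 2 w p * (pd 0 v p * pd 1 v p) = 0) := by
  obtain ⟨hA, -, -, -⟩ := hABC
  obtain ⟨hA', -, -, hsum⟩ := hABC'
  obtain ⟨c, hc, hcw⟩ : ∃ c : R3 → ℝ, (∀ p ∈ U, c p ≠ 0) ∧
      ∀ p ∈ U,
        A' * pd 0 v p = c p * (A * pd 0 w p) ∧
        B' * pd 1 v p = c p * (B * pd 1 w p) ∧
        C' * pd 2 v p = c p * (C * pd 2 w p) := by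
    refine ⟨fun p => A' * pd 0 v p / (A * pd 0 w p), fun p hp => ?_, fun p hp => ?_⟩
    · exact div_ne_zero (mul_ne_zero hA' (hvn p hp).1) (mul_ne_zero hA (hwn p hp).1)
    · have hx := (hwn p hp).1
      obtain ⟨hy, hz⟩ := hB p hp
      refine ⟨?_, ?_, ?_⟩
      · field_simp
      · field_simp
        linear_combination hy
      · field_simp
        linear_combination hz
  refine ⟨⟨c, hc, hcw⟩, fun p hp ξ η ζ => ?_, fun p hp => ?_⟩
  · obtain ⟨hx, hy, hz⟩ := hcw p hp
    rw [hx, hy, hz, ← mul_eq_zero_iff_left (hc p hp)]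
    ring_nf
  · obtain ⟨hx, hy, hz⟩ := hcw p hp
    refine (mul_eq_zero_iff_left (hc p hp)).mp ?_
    linear_combination pd 0 v p * pd 1 v p * pd 2 v p * hsum
      - pd 1 v p * pd 2 v p * hx - pd 0 v p * pd 2 v p * hy - pd 0 v p * pd 1 v p * hz
end
end

section
/- For every integer d ≥ 1 there exists a constant E > 0, depending only on d, with the following property: for every r > 0 and every holomorphic function ψ on the open ball B_r = {x ∈ ℂ^d : ‖x‖ < r}, if at every point of B_r one has Σ_{k,l=1}^{d} |∂²ψ/∂x_k∂x_l|² ≤ (1/(E·r²))·Σ_{k=1}^{d} |∂ψ/∂x_k|², then for every ρ with 0 < ρ < r the image ψ(B_ρ) is a convex subset of ℂ (where ℂ is identified with ℝ² and convexity is real convexity). (The first inner lemma in the proof of Lemma 7.30.) -/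
noncomputable section

/-- Complex partial derivative of `f : ℂ^d → ℂ` in the `k`-th coordinate direction. -/
def cpd {d : ℕ} (k : Fin d) (f : EuclideanSpace ℂ (Fin d) → ℂ)
    (x : EuclideanSpace ℂ (Fin d)) : ℂ :=
  fderiv ℂ f x (EuclideanSpace.single k 1)

open Metric Filter Topology MeasureTheory

/-- Directional derivatives of a holomorphic function of several variables are holomorphic. -/
theorem differentiableOn_fderiv_apply {E : Type*} [NormedAddCommGroup E]
    [NormedSpace ℂ E] [FiniteDimensional ℂ E] {f : E → ℂ} {U : Set E} (hU : IsOpen U)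
    (hf : DifferentiableOn ℂ f U) (v : E) :
    DifferentiableOn ℂ (fun y => fderiv ℂ f y v) U := by
  intro x hx
  refine DifferentiableAt.differentiableWithinAt ?_
  borelize E
  have hd : ∀ y ∈ U, DifferentiableAt ℂ f y := fun y hy => hf.differentiableAt (hU.mem_nhds hy)
  obtain ⟨δ, hδ, hδU⟩ : ∃ δ > 0, ball x (4 * δ) ⊆ U ∩ f ⁻¹' closedBall (f x) 1 := by
    obtain ⟨η, hη, h⟩ := Metric.mem_nhds_iff.1 (inter_mem (hU.mem_nhds hx)
      ((hd x hx).continuousAt.preimage_mem_nhds (closedBall_mem_nhds _ one_pos)))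
    exact ⟨η / 4, by positivity, by rwa [mul_div_cancel₀ _ four_ne_zero]⟩
  have bound : ∀ y ∈ ball x (2 * δ), ‖fderiv ℂ f y‖ ≤ 2 / (2 * δ) := by
    intro y hy
    have hsub : ball y (2 * δ) ⊆ ball x (4 * δ) :=
      ball_subset_ball' (by rw [mem_ball] at hy; linarith)
    refine Complex.norm_fderiv_le_div_of_mapsTo_ball
      (hf.mono fun z hz => (hδU (hsub hz)).1) (fun z hz => ?_) (by positivity)
    have h1 : dist (f z) (f x) ≤ 1 := (hδU (hsub hz)).2
    have h2 : dist (f y) (f x) ≤ 1 := (hδU (hsub (mem_ball_self (by positivity)))).2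
    rw [mem_closedBall]
    linarith [dist_triangle_right (f z) (f y) (f x)]
  set R : ℝ := δ / (‖v‖ + 1)
  have hR : 0 < R := by positivity
  have hRv : R * ‖v‖ < δ := by
    simp only [R]
    rw [div_mul_eq_mul_div, div_lt_iff₀ (by positivity)]
    nlinarith [norm_nonneg v]
  have hmem : ∀ y ∈ ball x δ, ∀ z ∈ closedBall (0 : ℂ) R, y + z • v ∈ ball x (2 * δ) := by
    intro y hy z hz
    rw [mem_ball, dist_eq_norm] at hy ⊢
    rw [mem_closedBall_zero_iff] at hz
    calc ‖y + z • v - x‖ = ‖(y - x) + z • v‖ := by congr 1; abel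
      _ ≤ ‖y - x‖ + ‖z‖ * ‖v‖ := (norm_add_le _ _).trans_eq (by rw [norm_smul])
      _ < 2 * δ := by nlinarith [mul_le_mul_of_nonneg_right hz (norm_nonneg v)]
  have hmemU : ∀ y ∈ ball x δ, ∀ z ∈ closedBall (0 : ℂ) R, y + z • v ∈ U := fun y hy z hz =>
    (hδU (ball_subset_ball (by linarith) (hmem y hy z hz))).1
  have hcm : ∀ θ, circleMap 0 R θ ∈ closedBall (0 : ℂ) R := circleMap_mem_closedBall 0 hR.le
  set c : ℝ → ℂ := fun θ => deriv (circleMap 0 R) θ * (1 / (circleMap 0 R θ) ^ 2)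
  have hc : Continuous c := by
    have h0 : ∀ θ, circleMap 0 R θ ^ 2 ≠ 0 := fun θ => by simp [hR.ne']
    simp only [c, deriv_circleMap]
    exact ((continuous_circleMap 0 R).mul continuous_const).mul
      (continuous_const.div ((continuous_circleMap 0 R).pow 2) h0)
  have hcont : ∀ y ∈ ball x δ, Continuous fun θ => c θ • f (y + circleMap 0 R θ • v) := by
    intro y hy
    refine hc.smul (continuous_iff_continuousAt.2 fun θ => ?_)
    refine ContinuousAt.comp (f := fun θ => y + circleMap 0 R θ • v)
      (hd _ (hmemU y hy _ (hcm θ))).continuousAt ?_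
    fun_prop
  have key : HasFDerivAt (fun y => ∫ θ in (0 : ℝ)..2 * Real.pi, c θ • f (y + circleMap 0 R θ • v))
      (∫ θ in (0 : ℝ)..2 * Real.pi, c θ • fderiv ℂ f (x + circleMap 0 R θ • v)) x := by
    refine intervalIntegral.hasFDerivAt_integral_of_dominated_of_fderiv_le
      (F' := fun y θ => c θ • fderiv ℂ f (y + circleMap 0 R θ • v))
      (bound := fun θ => ‖c θ‖ * (2 / (2 * δ))) (ball_mem_nhds x hδ) ?_ ?_ ?_ ?_ ?_ ?_
    · filter_upwards [ball_mem_nhds x hδ] with y hy using (hcont y hy).aestronglyMeasurable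
    · exact (hcont x (mem_ball_self hδ)).intervalIntegrable _ _
    · have : FiniteDimensional ℝ E := FiniteDimensional.complexToReal E
      have : ProperSpace E := FiniteDimensional.proper ℝ E
      refine hc.aestronglyMeasurable.smul (Measurable.aestronglyMeasurable ?_)
      have h : Continuous fun θ => x + circleMap 0 R θ • v := by fun_prop
      exact (measurable_fderiv ℂ f).comp h.measurable
    · refine .of_forall fun θ _ y hy => ?_
      rw [norm_smul]
      exact mul_le_mul_of_nonneg_left (bound _ (hmem y hy _ (hcm θ))) (norm_nonneg _)
    · exact (hc.norm.mul continuous_const).intervalIntegrable _ _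
    · refine .of_forall fun θ _ y hy => HasFDerivAt.const_smul ?_ (c θ)
      exact (hasFDerivAt_comp_add_right _).2 (hd _ (hmemU y hy _ (hcm θ))).hasFDerivAt
  have hformula : ∀ y ∈ ball x δ, fderiv ℂ f y v = (2 * Real.pi * Complex.I)⁻¹ •
      ∫ θ in (0 : ℝ)..2 * Real.pi, c θ • f (y + circleMap 0 R θ • v) := by
    intro y hy
    have hyU : y ∈ U := by simpa using hmemU y hy 0 (by simp [hR.le])
    have h1 : deriv (fun z : ℂ => f (y + z • v)) 0 = fderiv ℂ f y v :=
      (hd y hyU).lineDeriv_eq_fderiv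
    have h2 := DifferentiableOn.deriv_eq_smul_circleIntegral (c := 0)
      (f := fun z : ℂ => f (y + z • v)) hR fun z hz =>
        ((hd _ (hmemU y hy z hz)).comp z (f := fun z : ℂ => y + z • v)
          (by fun_prop)).differentiableWithinAt
    rw [← h1, eq_inv_smul_iff₀ Complex.two_pi_I_ne_zero, ← h2]
    simp only [circleIntegral, c, sub_zero, smul_smul]
  refine (key.differentiableAt.const_smul (2 * Real.pi * Complex.I : ℂ)⁻¹).congr_of_eventuallyEq ?_
  filter_upwards [ball_mem_nhds x hδ] with y hy using hformula y hy

/-- A differentiable function whose derivative is bounded by a multiple of the function itself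
grows at most exponentially along segments. -/
theorem norm_le_mul_exp_of_norm_fderiv_le {E F : Type*} [NormedAddCommGroup E] [NormedSpace ℂ E]
    [NormedAddCommGroup F] [NormedSpace ℂ F] {G : E → F} {s : Set E} {C : ℝ}
    (hs : Convex ℝ s) (hG : ∀ x ∈ s, DifferentiableAt ℂ G x)
    (bound : ∀ x ∈ s, ‖fderiv ℂ G x‖ ≤ C * ‖G x‖) {x y : E} (hx : x ∈ s) (hy : y ∈ s) :
    ‖G x‖ ≤ ‖G y‖ * Real.exp (C * ‖x - y‖) := by
  have hmem : ∀ τ ∈ Set.Icc (0 : ℝ) 1, y + τ • (x - y) ∈ s :=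
    fun τ hτ => hs.add_smul_sub_mem hy hx hτ
  have hder : ∀ τ ∈ Set.Icc (0 : ℝ) 1, HasDerivAt (fun τ : ℝ => G (y + τ • (x - y)))
      (fderiv ℂ G (y + τ • (x - y)) (x - y)) τ := by
    intro τ hτ
    have h1 : HasDerivAt (fun τ : ℝ => y + τ • (x - y)) (x - y) τ := by
      simpa using ((hasDerivAt_id τ).smul_const (x - y)).const_add y
    exact ((hG _ (hmem τ hτ)).hasFDerivAt.restrictScalars ℝ).comp_hasDerivAt τ h1
  have := norm_le_gronwallBound_of_norm_deriv_right_le (δ := ‖G y‖) (K := C * ‖x - y‖) (ε := 0)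
    (fun τ hτ => (hder τ hτ).continuousAt.continuousWithinAt)
    (fun τ hτ => (hder τ (Set.Ico_subset_Icc_self hτ)).hasDerivWithinAt) (by simp)
    (fun τ hτ => by
      have hb := bound _ (hmem τ (Set.Ico_subset_Icc_self hτ))
      refine (ContinuousLinearMap.le_of_opNorm_le _ hb _).trans_eq ?_
      ring) 1 (by simp)
  simpa [gronwallBound_ε0] using this

/-- First-order Taylor estimate for a function with Lipschitz derivative at `x`. -/
theorem norm_sub_sub_fderiv_le_of_lipschitz {E : Type*} [NormedAddCommGroup E] [NormedSpace ℂ E]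
    {f : E → ℂ} {s : Set E} {L : ℝ} (hs : Convex ℝ s) (hf : ∀ y ∈ s, DifferentiableAt ℂ f y)
    {x y : E} (hx : x ∈ s) (hy : y ∈ s) (hL : 0 ≤ L)
    (lip : ∀ z ∈ s, ‖fderiv ℂ f z - fderiv ℂ f x‖ ≤ L * ‖z - x‖) :
    ‖f y - f x - fderiv ℂ f x (y - x)‖ ≤ L * ‖y - x‖ ^ 2 := by
  have hsub : segment ℝ x y ⊆ s := hs.segment_subset hx hy
  have := (convex_segment (𝕜 := ℝ) x y).norm_image_sub_le_of_norm_fderiv_le' (f := f) (𝕜 := ℂ)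
    (φ := fderiv ℂ f x) (C := L * ‖y - x‖) (fun z hz => hf z (hsub hz))
    (fun z hz => (lip z (hsub hz)).trans
      (mul_le_mul_of_nonneg_left (norm_sub_le_of_mem_segment hz) hL))
    (left_mem_segment ℝ x y) (right_mem_segment ℝ x y)
  exact this.trans_eq (by ring)

/-- For a function with Lipschitz derivative, the image of a convex combination of two points
differs from the convex combination of the images by a quadratic term in their distance. -/
theorem norm_convexCombination_sub_le_of_lipschitz {E : Type*} [NormedAddCommGroup E]
    [NormedSpace ℂ E] {f : E → ℂ} {s : Set E} {L : ℝ} (hs : Convex ℝ s)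
    (hf : ∀ y ∈ s, DifferentiableAt ℂ f y) {p q : E} (hp : p ∈ s) (hq : q ∈ s) {a b : ℝ}
    (ha : 0 ≤ a) (hb : 0 ≤ b) (hab : a + b = 1) (hL : 0 ≤ L)
    (lip : ∀ z ∈ s, ‖fderiv ℂ f z - fderiv ℂ f (a • p + b • q)‖ ≤ L * ‖z - (a • p + b • q)‖) :
    ‖(a • f p + b • f q) - f (a • p + b • q)‖ ≤ L * (a * b * ‖p - q‖ ^ 2) := by
  have hpm : p - (a • p + b • q) = b • (p - q) := by
    rw [← eq_sub_iff_add_eq] at hab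
    rw [hab]
    module
  have hqm : q - (a • p + b • q) = (-a) • (p - q) := by
    rw [← eq_sub_iff_add_eq'] at hab
    rw [hab]
    module
  have hm : a • p + b • q ∈ s := hs hp hq ha hb hab
  generalize a • p + b • q = m at *
  have hTp := norm_sub_sub_fderiv_le_of_lipschitz hs hf hm hp hL lip
  have hTq := norm_sub_sub_fderiv_le_of_lipschitz hs hf hm hq hL lip
  have e : (a • f p + b • f q) - f m = a • (f p - f m - fderiv ℂ f m (p - m)) +
      b • (f q - f m - fderiv ℂ f m (q - m)) := by
    have h0 : a • (p - m) + b • (q - m) = 0 := by rw [hpm, hqm]; module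
    have h1 := congrArg ((fderiv ℂ f m).restrictScalars ℝ) h0
    rw [map_add, map_smul, map_smul, map_zero] at h1
    simp only [ContinuousLinearMap.coe_restrictScalars'] at h1
    have h2 : f m = a • f m + b • f m := by rw [← add_smul, hab, one_smul]
    rw [smul_sub, smul_sub, smul_sub, smul_sub]
    linear_combination h1 - h2
  have hpn : ‖p - m‖ = b * ‖p - q‖ := by rw [hpm, norm_smul, Real.norm_of_nonneg hb]
  have hqn : ‖q - m‖ = a * ‖p - q‖ := by rw [hqm, norm_smul, norm_neg, Real.norm_of_nonneg ha]
  rw [hpn] at hTp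
  rw [hqn] at hTq
  rw [e]
  refine (norm_add_le _ _).trans ?_
  rw [norm_smul, norm_smul, Real.norm_of_nonneg ha, Real.norm_of_nonneg hb]
  calc _ ≤ a * (L * (b * ‖p - q‖) ^ 2) + b * (L * (a * ‖p - q‖) ^ 2) := by gcongr
    _ = L * (a * b * ‖p - q‖ ^ 2) * (a + b) := by ring
    _ = L * (a * b * ‖p - q‖ ^ 2) := by rw [hab, mul_one]

theorem norm_sq_convexCombination {E : Type*} [NormedAddCommGroup E] [InnerProductSpace ℂ E]
    (p q : E) {a b : ℝ} (hab : a + b = 1) :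
    ‖a • p + b • q‖ ^ 2 = a * ‖p‖ ^ 2 + b * ‖q‖ ^ 2 - a * b * ‖p - q‖ ^ 2 := by
  obtain rfl : b = 1 - a := by linarith
  let _ : InnerProductSpace ℝ E := InnerProductSpace.rclikeToReal ℂ E
  rw [norm_add_sq_real, norm_sub_sq_real, norm_smul, norm_smul, real_inner_smul_left,
    real_inner_smul_right, mul_pow, mul_pow, Real.norm_eq_abs, Real.norm_eq_abs, sq_abs, sq_abs]
  ring

/-- If the derivative of a holomorphic function has small relative oscillation, then the image of a
small ball contains a disc of comparable radius. -/
theorem mem_image_closedBall_of_lipschitz_fderiv {E : Type*} [NormedAddCommGroup E]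
    [NormedSpace ℂ E] {f : E → ℂ} {m : E} {s L : ℝ} (hs : 0 < s)
    (hf : ∀ y ∈ closedBall m s, DifferentiableAt ℂ f y) (hL : 0 ≤ L)
    (lip : ∀ z ∈ closedBall m s, ‖fderiv ℂ f z - fderiv ℂ f m‖ ≤ L * ‖z - m‖)
    (hm : fderiv ℂ f m ≠ 0) {w : ℂ}
    (hw : ‖w - f m‖ < (‖fderiv ℂ f m‖ / 2 - L * s) * s / 2) :
    w ∈ f '' closedBall m s := by
  have hM : 0 < ‖fderiv ℂ f m‖ := norm_pos_iff.2 hm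
  obtain ⟨v, hv, hMv⟩ := (fderiv ℂ f m).exists_lt_apply_of_lt_opNorm (half_lt_self hM)
  have hmem : ∀ z ∈ closedBall (0 : ℂ) s, m + z • v ∈ closedBall m s := by
    intro z hz
    rw [mem_closedBall_zero_iff] at hz
    rw [mem_closedBall, dist_eq_norm, add_sub_cancel_left, norm_smul]
    nlinarith [norm_nonneg v, norm_nonneg z]
  have hmm : m ∈ closedBall m s := mem_closedBall_self hs.le
  have hdiff : DifferentiableOn ℂ (fun z : ℂ => f (m + z • v)) (closedBall 0 s) := fun z hz =>
    ((hf _ (hmem z hz)).comp z (f := fun z : ℂ => m + z • v) (by fun_prop)).differentiableWithinAt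
  have hsphere : ∀ z ∈ sphere (0 : ℂ) s,
      (‖fderiv ℂ f m‖ / 2 - L * s) * s ≤ ‖f (m + z • v) - f (m + (0 : ℂ) • v)‖ := by
    intro z hz
    have hT := norm_sub_sub_fderiv_le_of_lipschitz (convex_closedBall m s) hf hmm
      (hmem z (sphere_subset_closedBall hz)) hL lip
    rw [mem_sphere_zero_iff_norm] at hz
    rw [add_sub_cancel_left, map_smul] at hT
    have h1 : ‖z • fderiv ℂ f m v‖ = s * ‖fderiv ℂ f m v‖ := by rw [norm_smul, hz]
    have h2 : ‖z • v‖ ≤ s := by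
      rw [norm_smul, hz]; exact mul_le_of_le_one_right hs.le hv.le
    have h3 : L * ‖z • v‖ ^ 2 ≤ L * s ^ 2 := by gcongr
    have h4 := norm_sub_norm_le (z • fderiv ℂ f m v) (f (m + z • v) - f m)
    rw [norm_sub_rev (z • fderiv ℂ f m v)] at h4
    rw [zero_smul, add_zero]
    nlinarith
  have hne : ∃ᶠ z in 𝓝 (0 : ℂ), f (m + z • v) ≠ f (m + (0 : ℂ) • v) := by
    have h1 : HasDerivAt (fun z : ℂ => f (m + z • v)) (fderiv ℂ f m v) 0 :=
      (hf m hmm).hasFDerivAt.hasLineDerivAt v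
    have h2 : fderiv ℂ f m v ≠ 0 := norm_pos_iff.1 (by linarith)
    exact ((h1.eventually_ne h2).frequently).filter_mono nhdsWithin_le_nhds
  obtain ⟨z, hz, rfl⟩ := (hdiff.diffContOnCl_ball subset_rfl).ball_subset_image_closedBall hs
    hsphere hne (by simpa [dist_eq_norm] using hw)
  exact ⟨_, hmem z hz, rfl⟩

/-- A holomorphic function whose derivative has small relative Lipschitz constant on a ball maps
concentric smaller balls onto convex sets. -/
theorem convex_image_ball_of_lipschitz_fderiv {E : Type*} [NormedAddCommGroup E]
    [InnerProductSpace ℂ E] {f : E → ℂ} {r ρ : ℝ} (hf : ∀ y ∈ ball 0 r, DifferentiableAt ℂ f y)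
    (lip : ∀ x ∈ ball (0 : E) r, ∀ y ∈ ball (0 : E) r,
      ‖fderiv ℂ f x - fderiv ℂ f y‖ ≤ 1 / (16 * r) * ‖fderiv ℂ f y‖ * ‖x - y‖)
    (hρ : 0 < ρ) (hρr : ρ < r) :
    Convex ℝ (f '' ball 0 ρ) := by
  have hr : 0 < r := hρ.trans hρr
  rw [convex_iff_forall_pos]
  rintro _ ⟨p, hp, rfl⟩ _ ⟨q, hq, rfl⟩ a b ha hb hab
  rcases eq_or_ne p q with rfl | hpq
  · exact ⟨p, hp, (Convex.combo_self hab _).symm⟩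
  have hsub : ball (0 : E) ρ ⊆ ball 0 r := ball_subset_ball hρr.le
  set m := a • p + b • q with hm_def
  have hm : m ∈ ball (0 : E) ρ := convex_ball 0 ρ hp hq ha.le hb.le hab
  have hD : 0 < ‖p - q‖ := norm_pos_iff.2 (sub_ne_zero.2 hpq)
  set M := ‖fderiv ℂ f m‖ with hM_def
  have hL : 0 ≤ 1 / (16 * r) * M := by positivity
  set L := 1 / (16 * r) * M with hL_def
  have hLr : L * r = M / 16 := by rw [hL_def]; field_simp
  set s := a * b * ‖p - q‖ ^ 2 / (2 * ρ) with hs_def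
  have hs : 0 < s := by positivity
  have hsρ : a * b * ‖p - q‖ ^ 2 = 2 * ρ * s := by rw [hs_def]; field_simp
  have hms : ‖m‖ + s < ρ := by
    have h := norm_sq_convexCombination p q hab
    rw [← hm_def, hsρ] at h
    rw [mem_ball_zero_iff] at hp hq
    have h1 : ‖p‖ ^ 2 < ρ ^ 2 := by gcongr
    have h2 : ‖q‖ ^ 2 < ρ ^ 2 := by gcongr
    have h3 : ‖m‖ ^ 2 < ρ ^ 2 - 2 * ρ * s := by
      have : a * ρ ^ 2 + b * ρ ^ 2 = ρ ^ 2 := by rw [← add_mul, hab, one_mul]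
      nlinarith
    have h4 : 2 * s < ρ := by nlinarith [sq_nonneg ‖m‖]
    have h5 : ‖m‖ < ρ - s := lt_of_pow_lt_pow_left₀ 2 (by linarith) (by nlinarith)
    linarith
  have hclosed : closedBall m s ⊆ ball 0 ρ :=
    closedBall_subset_ball' (by rw [dist_zero_right]; linarith)
  have hw : ‖(a • f p + b • f q) - f m‖ ≤ L * (2 * ρ * s) :=
    hsρ ▸ norm_convexCombination_sub_le_of_lipschitz (convex_ball 0 r) hf (hsub hp) (hsub hq)
      ha.le hb.le hab hL fun z hz => lip z hz m (hsub hm)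
  rcases eq_or_ne (fderiv ℂ f m) 0 with h0 | h0
  · have hL0 : L = 0 := by rw [hL_def, hM_def, h0, norm_zero, mul_zero]
    rw [hL0, zero_mul, norm_le_zero_iff, sub_eq_zero] at hw
    exact ⟨m, hm, hw.symm⟩
  · have hM : 0 < M := norm_pos_iff.2 h0
    refine Set.image_mono hclosed (mem_image_closedBall_of_lipschitz_fderiv hs
      (fun y hy => hf y (hsub (hclosed hy))) hL
      (fun z hz => lip z (hsub (hclosed hz)) m (hsub hm)) h0 ?_)
    rw [← hM_def]
    have h1 : L * ρ ≤ M / 16 := hLr ▸ mul_le_mul_of_nonneg_left hρr.le hL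
    have h2 : L * s ≤ M / 16 :=
      (mul_le_mul_of_nonneg_left (by linarith [norm_nonneg m]) hL).trans h1
    nlinarith [mul_le_mul_of_nonneg_right h1 hs.le, mul_le_mul_of_nonneg_right h2 hs.le,
      mul_pos hM hs]

theorem norm_sum_mul_le {d : ℕ} (v w : EuclideanSpace ℂ (Fin d)) :
    ‖∑ k, v k * w k‖ ≤ ‖v‖ * ‖w‖ := by
  rw [EuclideanSpace.norm_eq, EuclideanSpace.norm_eq]
  refine (norm_sum_le _ _).trans ?_
  simp_rw [norm_mul]
  exact Real.sum_mul_le_sqrt_mul_sqrt _ _ _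

theorem fderiv_apply_eq_sum_cpd {d : ℕ} (f : EuclideanSpace ℂ (Fin d) → ℂ)
    (x v : EuclideanSpace ℂ (Fin d)) : fderiv ℂ f x v = ∑ k, v k * cpd k f x := by
  conv_lhs => rw [← (EuclideanSpace.basisFun (Fin d) ℂ).sum_repr v]
  simp [cpd]

/-- The vector of all complex partial derivatives. -/
def cgrad {d : ℕ} (f : EuclideanSpace ℂ (Fin d) → ℂ) (x : EuclideanSpace ℂ (Fin d)) :
    EuclideanSpace ℂ (Fin d) :=
  WithLp.toLp 2 fun k => cpd k f x

theorem norm_fderiv_sub_le_norm_cgrad_sub {d : ℕ} (f : EuclideanSpace ℂ (Fin d) → ℂ)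
    (x y : EuclideanSpace ℂ (Fin d)) :
    ‖fderiv ℂ f x - fderiv ℂ f y‖ ≤ ‖cgrad f x - cgrad f y‖ := by
  refine ContinuousLinearMap.opNorm_le_bound _ (norm_nonneg _) fun v => ?_
  have h := norm_sum_mul_le v (cgrad f x - cgrad f y)
  rw [mul_comm]
  simpa [fderiv_apply_eq_sum_cpd, cgrad, mul_sub, Finset.sum_sub_distrib] using h

theorem norm_cgrad_le_norm_fderiv {d : ℕ} (f : EuclideanSpace ℂ (Fin d) → ℂ)
    (x : EuclideanSpace ℂ (Fin d)) : ‖cgrad f x‖ ≤ ‖fderiv ℂ f x‖ := by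
  set v : EuclideanSpace ℂ (Fin d) := WithLp.toLp 2 fun k => star (cpd k f x)
  have hv : ‖v‖ = ‖cgrad f x‖ := by simp [EuclideanSpace.norm_eq, v, cgrad]
  have h1 : fderiv ℂ f x v = (‖cgrad f x‖ ^ 2 : ℝ) := by
    rw [fderiv_apply_eq_sum_cpd, EuclideanSpace.norm_sq_eq]
    simp [v, cgrad, Complex.conj_mul']
  have h2 := (fderiv ℂ f x).le_opNorm v
  rw [h1, hv, Complex.norm_real, Real.norm_of_nonneg (by positivity), sq] at h2
  rcases (norm_nonneg (cgrad f x)).eq_or_lt with h0 | h0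
  · rw [← h0]; exact norm_nonneg _
  · exact le_of_mul_le_mul_right h2 h0

theorem differentiableAt_cgrad {d : ℕ} {f : EuclideanSpace ℂ (Fin d) → ℂ}
    {U : Set (EuclideanSpace ℂ (Fin d))} (hU : IsOpen U) (hf : DifferentiableOn ℂ f U)
    {x : EuclideanSpace ℂ (Fin d)} (hx : x ∈ U) : DifferentiableAt ℂ (cgrad f) x :=
  differentiableAt_euclidean.2 fun k =>
    (differentiableOn_fderiv_apply hU hf (EuclideanSpace.single k 1)).differentiableAt
      (hU.mem_nhds hx)

theorem norm_fderiv_cgrad_le {d : ℕ} {f : EuclideanSpace ℂ (Fin d) → ℂ}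
    {x : EuclideanSpace ℂ (Fin d)} (hx : DifferentiableAt ℂ (cgrad f) x) :
    ‖fderiv ℂ (cgrad f) x‖ ≤ √(∑ k : Fin d, ∑ l : Fin d, ‖cpd k (cpd l f) x‖ ^ 2) := by
  refine ContinuousLinearMap.opNorm_le_bound _ (Real.sqrt_nonneg _) fun v => ?_
  have hcoord : ∀ l, fderiv ℂ (cgrad f) x v l = ∑ k, v k * cpd k (cpd l f) x := fun l => by
    have h := ((EuclideanSpace.proj l).hasFDerivAt.comp x hx.hasFDerivAt).fderiv
    rw [← fderiv_apply_eq_sum_cpd]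
    exact (DFunLike.congr_fun h v).symm
  refine (sq_le_sq₀ (norm_nonneg _) (by positivity)).1 ?_
  rw [EuclideanSpace.norm_sq_eq (fderiv ℂ (cgrad f) x v), mul_pow,
    Real.sq_sqrt (by positivity), Finset.sum_comm, Finset.sum_mul]
  refine Finset.sum_le_sum fun l _ => ?_
  rw [hcoord]
  have h := norm_sum_mul_le v (WithLp.toLp 2 fun k => cpd k (cpd l f) x)
  calc _ ≤ (‖v‖ * ‖(WithLp.toLp 2 fun k => cpd k (cpd l f) x : EuclideanSpace ℂ (Fin d))‖) ^ 2 := by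
        gcongr
    _ = _ := by rw [mul_pow, mul_comm, EuclideanSpace.norm_sq_eq (WithLp.toLp 2 _)]

/-- The first inner lemma in the proof of Lemma 7.30: there is a constant `E > 0`
depending only on `d` such that any holomorphic function `ψ` on the ball `B_r`
whose second derivatives are dominated by `(1/(E·r²))` times its first
derivatives (in the sense of sums of squared absolute values, at every point)
has convex image `ψ(B_ρ)` for every `0 < ρ < r`. -/
theorem convex_image_of_small_second_derivatives
    (d : ℕ) (hd : 1 ≤ d) :
    ∃ E : ℝ, 0 < E ∧
      ∀ (r : ℝ), 0 < r →
        ∀ ψ : EuclideanSpace ℂ (Fin d) → ℂ,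
          DifferentiableOn ℂ ψ (Metric.ball 0 r) →
          (∀ x ∈ Metric.ball (0 : EuclideanSpace ℂ (Fin d)) r,
            ∑ k : Fin d, ∑ l : Fin d, ‖cpd k (cpd l ψ) x‖ ^ 2 ≤
              (1 / (E * r ^ 2)) * ∑ k : Fin d, ‖cpd k ψ x‖ ^ 2) →
          ∀ ρ : ℝ, 0 < ρ → ρ < r →
            Convex ℝ (ψ '' Metric.ball (0 : EuclideanSpace ℂ (Fin d)) ρ) := by
  refine ⟨32 ^ 2, by norm_num, fun r hr ψ hψ hsmall ρ hρ hρr => ?_⟩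
  have hdG : ∀ x ∈ ball (0 : EuclideanSpace ℂ (Fin d)) r, DifferentiableAt ℂ (cgrad ψ) x :=
    fun x hx => differentiableAt_cgrad isOpen_ball hψ hx
  have hbound : ∀ x ∈ ball (0 : EuclideanSpace ℂ (Fin d)) r,
      ‖fderiv ℂ (cgrad ψ) x‖ ≤ 1 / (32 * r) * ‖cgrad ψ x‖ := by
    intro x hx
    refine (norm_fderiv_cgrad_le (hdG x hx)).trans ?_
    rw [Real.sqrt_le_left (by positivity), mul_pow, EuclideanSpace.norm_sq_eq]
    rw [div_pow, one_pow, mul_pow]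
    exact hsmall x hx
  refine convex_image_ball_of_lipschitz_fderiv
    (fun y hy => hψ.differentiableAt (isOpen_ball.mem_nhds hy)) (fun x hx y hy => ?_) hρ hρr
  have hgrowth : ∀ z ∈ ball (0 : EuclideanSpace ℂ (Fin d)) r, ‖cgrad ψ z‖ ≤ ‖cgrad ψ y‖ * 2 := by
    intro z hz
    refine (norm_le_mul_exp_of_norm_fderiv_le (convex_ball 0 r) hdG hbound hz hy).trans ?_
    refine mul_le_mul_of_nonneg_left ?_ (norm_nonneg _)
    have hzy : 1 / (32 * r) * ‖z - y‖ ≤ 1 / 16 := by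
      rw [mem_ball_zero_iff] at hz hy
      rw [div_mul_eq_mul_div, div_le_iff₀ (by positivity)]
      linarith [norm_sub_le z y]
    rw [← Real.le_log_iff_exp_le two_pos]
    linarith [Real.log_two_gt_d9]
  refine (norm_fderiv_sub_le_norm_cgrad_sub ψ x y).trans ?_
  calc ‖cgrad ψ x - cgrad ψ y‖ ≤ 1 / (32 * r) * (‖cgrad ψ y‖ * 2) * ‖x - y‖ :=
        (convex_ball 0 r).norm_image_sub_le_of_norm_fderiv_le hdG
          (fun z hz => (hbound z hz).trans
            (mul_le_mul_of_nonneg_left (hgrowth z hz) (by positivity))) hy hx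
    _ = 1 / (16 * r) * ‖cgrad ψ y‖ * ‖x - y‖ := by field_simp; ring
    _ ≤ 1 / (16 * r) * ‖fderiv ℂ ψ y‖ * ‖x - y‖ := by
        gcongr
        exact norm_cgrad_le_norm_fderiv ψ y
end
end

section
/- For every integer d ≥ 1 there exist constants F > 0 and D > 0, depending only on d, with the following property: for every r > 0, every holomorphic function ψ on the open polydisk P_r = {x ∈ ℂ^d : |x_k| < r for k = 1,…,d}, all complex numbers a₁,…,a_d and every c ∈ ℂ, if |∂ψ/∂x_k(x) − a_k| < |a_k|/F for every x ∈ P_r and every k, then for every ρ with 0 < ρ < r/D: the image ψ(P_ρ) is a convex subset of ℂ (real convexity under the identification ℂ ≅ ℝ²), and the level set ψ⁻¹(c) ∩ P_ρ is connected whenever it is non-empty. (The second inner lemma in the proof of Lemma 7.30.) -/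
noncomputable section

/-- The open polydisk of polyradius `(r, …, r)` centered at the origin of `ℂ^d`. -/
def Polydisk (d : ℕ) (r : ℝ) : Set (EuclideanSpace ℂ (Fin d)) :=
  {x | ∀ k : Fin d, ‖x k‖ < r}

open Set Metric

namespace Polydisk

variable {d : ℕ} {r ρ : ℝ} {E : EuclideanSpace ℂ (Fin d) → ℂ} {b : Fin d → ℝ}

theorem isOpen (d : ℕ) (r : ℝ) : IsOpen (Polydisk d r) := by
  have h : Polydisk d r = ⋂ k : Fin d, {x | ‖x k‖ < r} := by
    ext x
    simp [Polydisk]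
  rw [h]
  exact isOpen_iInter_of_finite fun k => isOpen_lt (by fun_prop) continuous_const

theorem mono (h : ρ ≤ r) : Polydisk d ρ ⊆ Polydisk d r :=
  fun _ hx k => (hx k).trans_le h

theorem add_smul_sub_mem {p q : EuclideanSpace ℂ (Fin d)} (hp : p ∈ Polydisk d r)
    (hq : q ∈ Polydisk d r) {t : ℝ} (ht : t ∈ Icc (0 : ℝ) 1) :
    q + (t : ℂ) • (p - q) ∈ Polydisk d r := by
  intro k
  have h := (convex_ball (0 : ℂ) r).add_smul_sub_mem (x := q k) (y := p k)
    (by simpa using hq k) (by simpa using hp k) ht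
  simpa using h

theorem fderiv_apply_eq_sum (f : EuclideanSpace ℂ (Fin d) → ℂ) (x v : EuclideanSpace ℂ (Fin d)) :
    fderiv ℂ f x v = ∑ k, v k * cpd k f x := by
  have hv : v = ∑ k, v k • EuclideanSpace.single k (1 : ℂ) := by
    ext i
    simp [Finset.sum_apply, Pi.single_apply]
  conv_lhs => rw [hv]
  simp [cpd]

theorem hasDerivAt_comp_line (hE : DifferentiableOn ℂ E (Polydisk d r))
    (x v : EuclideanSpace ℂ (Fin d)) {z : ℂ} (hz : x + z • v ∈ Polydisk d r) :
    HasDerivAt (fun z : ℂ => E (x + z • v)) (∑ k, v k * cpd k E (x + z • v)) z := by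
  have h1 : HasFDerivAt E (fderiv ℂ E (x + z • v)) (x + z • v) :=
    (hE.differentiableAt ((isOpen d r).mem_nhds hz)).hasFDerivAt
  have h2 : HasDerivAt (fun z : ℂ => x + z • v) v z := by
    simpa using ((hasDerivAt_id z).smul_const v).const_add x
  rw [← fderiv_apply_eq_sum]
  exact h1.comp_hasDerivAt z h2

/-- A holomorphic function whose partial derivatives are bounded by `b` satisfies the
corresponding anisotropic Lipschitz estimate. -/
theorem norm_sub_le_sum (hE : DifferentiableOn ℂ E (Polydisk d r))
    (hb : ∀ x ∈ Polydisk d r, ∀ k, ‖cpd k E x‖ ≤ b k)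
    {p q : EuclideanSpace ℂ (Fin d)} (hp : p ∈ Polydisk d r) (hq : q ∈ Polydisk d r) :
    ‖E p - E q‖ ≤ ∑ k, b k * ‖p k - q k‖ := by
  have hd : ∀ t ∈ Icc (0 : ℝ) 1, HasDerivWithinAt (fun t : ℝ => E (q + (t : ℂ) • (p - q)))
      (∑ k, (p - q) k * cpd k E (q + (t : ℂ) • (p - q))) (Icc 0 1) t := fun t ht =>
    (hasDerivAt_comp_line hE q (p - q) (add_smul_sub_mem hp hq ht)).comp_ofReal.hasDerivWithinAt
  have h := norm_image_sub_le_of_norm_deriv_le_segment_01' hd (C := ∑ k, b k * ‖p k - q k‖) ?_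
  · simpa using h
  · intro t ht
    refine (norm_sum_le _ _).trans (Finset.sum_le_sum fun k _ => ?_)
    rw [norm_mul, mul_comm]
    exact mul_le_mul_of_nonneg_right
      (hb _ (add_smul_sub_mem hp hq (Ico_subset_Icc_self ht)) k) (norm_nonneg _)

theorem add_mem {s t : ℝ} {x y : EuclideanSpace ℂ (Fin d)} (hx : x ∈ Polydisk d s)
    (hy : ∀ k, ‖y k‖ ≤ t) : x + y ∈ Polydisk d (s + t) :=
  fun k => (norm_add_le (x k) (y k)).trans_lt (add_lt_add_of_lt_of_le (hx k) (hy k))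

theorem norm_smul_single_apply_le (z : ℂ) (j k : Fin d) :
    ‖(z • EuclideanSpace.single j (1 : ℂ)) k‖ ≤ ‖z‖ := by
  by_cases h : k = j <;> simp [h]

theorem hasDerivAt_sub_comp_single (hE : DifferentiableOn ℂ E (Polydisk d r))
    {p q : EuclideanSpace ℂ (Fin d)} (hp : p ∈ Polydisk d r) (hq : q ∈ Polydisk d r)
    (j : Fin d) :
    HasDerivAt (fun z : ℂ => E (p + z • EuclideanSpace.single j 1) -
      E (q + z • EuclideanSpace.single j 1)) (cpd j E p - cpd j E q) 0 := by
  have h := (hasDerivAt_comp_line hE p (EuclideanSpace.single j 1) (z := 0) (by simpa)).fun_sub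
    (hasDerivAt_comp_line hE q (EuclideanSpace.single j 1) (z := 0) (by simpa))
  simpa [Pi.single_apply] using h

/-- Estimate of the variation of `∂_j E` by the sizes of all partial derivatives. -/
theorem norm_cpd_sub_le_sum (hr : 0 < r) (hE : DifferentiableOn ℂ E (Polydisk d r))
    (hb : ∀ x ∈ Polydisk d r, ∀ k, ‖cpd k E x‖ ≤ b k)
    {p q : EuclideanSpace ℂ (Fin d)} (hp : p ∈ Polydisk d (r / 2)) (hq : q ∈ Polydisk d (r / 2))
    (j : Fin d) :
    ‖cpd j E p - cpd j E q‖ ≤ 4 / r * ∑ k, b k * ‖p k - q k‖ := by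
  have hmem : ∀ x ∈ Polydisk d (r / 2), ∀ z ∈ ball (0 : ℂ) (r / 2),
      x + z • EuclideanSpace.single j 1 ∈ Polydisk d r := fun x hx z hz => by
    have h := add_mem hx fun k =>
      (norm_smul_single_apply_le z j k).trans (mem_ball_zero_iff.1 hz).le
    rwa [add_halves] at h
  have hsub : Polydisk d (r / 2) ⊆ Polydisk d r := mono (by linarith)
  have hbound : ∀ z ∈ ball (0 : ℂ) (r / 2), ‖E (p + z • EuclideanSpace.single j 1) -
      E (q + z • EuclideanSpace.single j 1)‖ ≤ ∑ k, b k * ‖p k - q k‖ := fun z hz => by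
    simpa using norm_sub_le_sum hE hb (hmem p hp z hz) (hmem q hq z hz)
  have h0 : (0 : ℂ) ∈ ball (0 : ℂ) (r / 2) := mem_ball_self (by positivity)
  have h := Complex.norm_deriv_le_div_of_mapsTo_ball
    (f := fun z : ℂ => E (p + z • EuclideanSpace.single j 1) -
      E (q + z • EuclideanSpace.single j 1)) (c := 0) (R₁ := r / 2)
    (R₂ := 2 * ∑ k, b k * ‖p k - q k‖)
    (fun z hz => ((hasDerivAt_comp_line hE p _ (hmem p hp z hz)).sub
      (hasDerivAt_comp_line hE q _ (hmem q hq z hz))).differentiableAt.differentiableWithinAt)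
    (fun z hz => by
      rw [mem_closedBall, dist_eq_norm_sub, two_mul]
      exact (norm_sub_le _ _).trans (add_le_add (hbound z hz) (hbound 0 h0)))
    (by positivity)
  rw [(hasDerivAt_sub_comp_single hE (hsub hp) (hsub hq) j).deriv] at h
  refine h.trans_eq ?_
  field_simp
  ring

/-- Estimate of the variation of `∂_j E` by the size of `∂_j E` itself. -/
theorem norm_cpd_sub_le_self (hr : 0 < r) (hE : DifferentiableOn ℂ E (Polydisk d r))
    (hb : ∀ x ∈ Polydisk d r, ∀ k, ‖cpd k E x‖ ≤ b k)
    {p q : EuclideanSpace ℂ (Fin d)} (hp : p ∈ Polydisk d (r / 4)) (hq : q ∈ Polydisk d (r / 4))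
    (hpq : 2 * ∑ k, ‖p k - q k‖ < r) (j : Fin d) :
    ‖cpd j E p - cpd j E q‖ ≤ 4 / r * (b j * ∑ k, ‖p k - q k‖) := by
  have hsub : Polydisk d (r / 4) ⊆ Polydisk d r := mono (by linarith)
  have hb0 : 0 ≤ b j := (norm_nonneg _).trans (hb p (hsub hp) j)
  rcases eq_or_ne p q with rfl | hne
  · simp
  set η := ∑ k, ‖p k - q k‖ with hη
  have hle : ∀ k, ‖p k - q k‖ ≤ η := fun k =>
    Finset.single_le_sum (f := fun k => ‖p k - q k‖) (fun _ _ => norm_nonneg _)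
      (Finset.mem_univ k)
  have hη0 : 0 < η := by
    obtain ⟨k, hk⟩ : ∃ k, p k ≠ q k := by
      by_contra! h
      exact hne (by ext k; exact h k)
    exact (norm_pos_iff.2 (sub_ne_zero.2 hk)).trans_le (hle k)
  refine (hasDerivAt_sub_comp_single hE (hsub hp) (hsub hq) j).le_of_lip' (by positivity) ?_
  filter_upwards [ball_mem_nhds (0 : ℂ) (show 0 < r / 4 by positivity)] with ζ hζ
  have hζ' : ‖ζ‖ < r / 4 := mem_ball_zero_iff.1 hζ
  have hmem1 : ∀ z ∈ ball (0 : ℂ) (r / (2 * η)),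
      q + z • (p - q) ∈ Polydisk d (r / 4 + r / 2) := fun z hz => by
    refine add_mem hq fun k => ?_
    have hz' : ‖z‖ < r / (2 * η) := mem_ball_zero_iff.1 hz
    have h1 : ‖z‖ * ‖p k - q k‖ ≤ r / (2 * η) * η := by
      gcongr
      exact hle k
    have h2 : r / (2 * η) * η = r / 2 := by field_simp
    simpa [h2] using h1
  have hmem2 : ∀ z ∈ ball (0 : ℂ) (r / (2 * η)),
      (q + ζ • EuclideanSpace.single j 1) + z • (p - q) ∈ Polydisk d r := fun z hz => by
    have h := add_mem (hmem1 z hz) fun k => (norm_smul_single_apply_le ζ j k).trans hζ'.le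
    rw [add_right_comm]
    exact mono (by linarith) h
  have hmem1' : ∀ z ∈ ball (0 : ℂ) (r / (2 * η)), q + z • (p - q) ∈ Polydisk d r :=
    fun z hz => mono (by linarith) (hmem1 z hz)
  have hbound : ∀ z ∈ ball (0 : ℂ) (r / (2 * η)),
      ‖E ((q + ζ • EuclideanSpace.single j 1) + z • (p - q)) - E (q + z • (p - q))‖
        ≤ b j * ‖ζ‖ := fun z hz => by
    refine (norm_sub_le_sum hE hb (hmem2 z hz) (hmem1' z hz)).trans_eq ?_
    rw [Finset.sum_eq_single j]
    · simp
    · intro k _ hk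
      simp [hk]
    · simp
  have h0 : (0 : ℂ) ∈ ball (0 : ℂ) (r / (2 * η)) := mem_ball_self (by positivity)
  have h1 : (1 : ℂ) ∈ ball (0 : ℂ) (r / (2 * η)) := by
    rw [mem_ball_zero_iff, norm_one, lt_div_iff₀ (by positivity)]
    linarith
  have h := Complex.dist_le_div_mul_dist_of_mapsTo_ball
    (f := fun z : ℂ => E ((q + ζ • EuclideanSpace.single j 1) + z • (p - q)) -
      E (q + z • (p - q))) (c := 0) (R₁ := r / (2 * η)) (R₂ := 2 * (b j * ‖ζ‖)) (z := 1)
    (fun z hz => ((hasDerivAt_comp_line hE _ _ (hmem2 z hz)).sub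
      (hasDerivAt_comp_line hE _ _ (hmem1' z hz))).differentiableAt.differentiableWithinAt)
    (fun z hz => by
      rw [mem_closedBall, dist_eq_norm_sub, two_mul]
      exact (norm_sub_le _ _).trans (add_le_add (hbound z hz) (hbound 0 h0)))
    h1
  have hq1 : q + ζ • EuclideanSpace.single j (1 : ℂ) + (p - q) =
      p + ζ • EuclideanSpace.single j (1 : ℂ) := by abel
  simp only [dist_eq_norm_sub, one_smul, zero_smul, add_zero, sub_zero, norm_one, mul_one,
    add_sub_cancel, hq1] at h
  simp only [zero_smul, add_zero, sub_zero]
  refine (le_of_eq ?_).trans (h.trans_eq ?_)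
  · congr 1
    ring
  · field_simp
    ring

/-- The previous two estimates combined: mixed second differences are controlled by the smaller
of the two partial derivatives involved. -/
theorem norm_cpd_sub_le_sum_min (hr : 0 < r) (hE : DifferentiableOn ℂ E (Polydisk d r))
    (hb : ∀ x ∈ Polydisk d r, ∀ k, ‖cpd k E x‖ ≤ b k)
    {p q : EuclideanSpace ℂ (Fin d)} (hp : p ∈ Polydisk d (r / 4)) (hq : q ∈ Polydisk d (r / 4))
    (hpq : 2 * ∑ k, ‖p k - q k‖ < r) (j : Fin d) :
    ‖cpd j E p - cpd j E q‖ ≤ 4 / r * ∑ k, min (b j) (b k) * ‖p k - q k‖ := by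
  set m : EuclideanSpace ℂ (Fin d) := WithLp.toLp 2 fun k => if b k ≤ b j then p k else q k
    with hm
  have hmk : ∀ k, m k = if b k ≤ b j then p k else q k := fun k => rfl
  have hm4 : m ∈ Polydisk d (r / 4) := fun k => by
    rw [hmk]
    split_ifs
    exacts [hp k, hq k]
  have hsub : Polydisk d (r / 4) ⊆ Polydisk d (r / 2) := mono (by linarith)
  have hpm : 2 * ∑ k, ‖p k - m k‖ < r := by
    refine lt_of_le_of_lt ?_ hpq
    gcongr with k
    rw [hmk]
    split_ifs <;> simp
  have h1 := norm_cpd_sub_le_sum hr hE hb (hsub hm4) (hsub hq) j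
  have h2 := norm_cpd_sub_le_self hr hE hb hp hm4 hpm j
  calc ‖cpd j E p - cpd j E q‖ ≤ ‖cpd j E p - cpd j E m‖ + ‖cpd j E m - cpd j E q‖ :=
        norm_sub_le_norm_sub_add_norm_sub _ _ _
    _ ≤ _ := add_le_add h2 h1
    _ = _ := by
      rw [← mul_add, Finset.mul_sum, ← Finset.sum_add_distrib]
      congr 1
      refine Finset.sum_congr rfl fun k _ => ?_
      rw [hmk]
      split_ifs with h
      · simp [h]
      · simp [(not_le.1 h).le]

/-- Deviation from affinity on `[0, 1]` of a function with Lipschitz derivative. -/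
theorem norm_sub_convexComb_le {f f' : ℝ → ℂ} {K : ℝ}
    (hf : ∀ t ∈ Icc (0 : ℝ) 1, HasDerivAt f (f' t) t)
    (hK : ∀ s ∈ Icc (0 : ℝ) 1, ∀ t ∈ Icc (0 : ℝ) 1, ‖f' s - f' t‖ ≤ K * |s - t|)
    {t : ℝ} (ht : t ∈ Icc (0 : ℝ) 1) :
    ‖(t * f 1 + (1 - t) * f 0) - f t‖ ≤ K * (t * (1 - t)) := by
  have hK0 : 0 ≤ K := by
    simpa using (norm_nonneg _).trans (hK 1 (by simp) 0 (by simp))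
  have key : ∀ u ∈ Icc (0 : ℝ) 1, ‖f u - f t - (u - t) * f' t‖ ≤ K * |u - t| * |u - t| := by
    intro u hu
    have hsub : uIcc t u ⊆ Icc 0 1 := uIcc_subset_Icc ht hu
    have h := (convex_uIcc t u).norm_image_sub_le_of_norm_hasDerivWithin_le
      (f := fun s : ℝ => f s - s * f' t) (f' := fun s => f' s - f' t) (C := K * |u - t|)
      (fun s hs => by
        have h2 := (hf s (hsub hs)).fun_sub ((Complex.ofRealCLM.hasDerivAt (x := s)).mul_const (f' t))
        simpa using h2.hasDerivWithinAt)
      (fun s hs => (hK s (hsub hs) t ht).trans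
        (mul_le_mul_of_nonneg_left (abs_sub_left_of_mem_uIcc hs) hK0))
      left_mem_uIcc right_mem_uIcc
    rw [Real.norm_eq_abs] at h
    refine (le_of_eq ?_).trans h
    congr 1
    ring
  have h1 := key 1 (by simp)
  have h0 := key 0 (by simp)
  rw [mul_assoc, abs_mul_abs_self] at h1 h0
  have heq : (t * f 1 + (1 - t) * f 0) - f t =
      (t : ℂ) * (f 1 - f t - ((1 : ℝ) - t) * f' t) +
        ((1 - t : ℝ) : ℂ) * (f 0 - f t - ((0 : ℝ) - t) * f' t) := by
    push_cast
    ring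
  rw [heq]
  refine (norm_add_le _ _).trans ?_
  rw [norm_mul, norm_mul, Complex.norm_of_nonneg ht.1, Complex.norm_of_nonneg (sub_nonneg.2 ht.2)]
  calc _ ≤ t * (K * ((1 - t) * (1 - t))) + (1 - t) * (K * ((0 - t) * (0 - t))) :=
        add_le_add (mul_le_mul_of_nonneg_left h1 ht.1)
          (mul_le_mul_of_nonneg_left h0 (sub_nonneg.2 ht.2))
    _ = _ := by ring

theorem sum_sum_min_mul_le (hb : ∀ k, 0 ≤ b k) (x : Fin d → ℝ) :
    ∑ j, x j * ∑ k, min (b j) (b k) * x k ≤ d * ∑ k, b k * x k ^ 2 := by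
  have h : ∀ j k, x j * (min (b j) (b k) * x k) ≤ (b j * x j ^ 2 + b k * x k ^ 2) / 2 := by
    intro j k
    have h1 : min (b j) (b k) * x j ^ 2 ≤ b j * x j ^ 2 := by gcongr; exact min_le_left _ _
    have h2 : min (b j) (b k) * x k ^ 2 ≤ b k * x k ^ 2 := by gcongr; exact min_le_right _ _
    nlinarith [mul_nonneg (le_min (hb j) (hb k)) (sq_nonneg (x j - x k))]
  calc ∑ j, x j * ∑ k, min (b j) (b k) * x k
      ≤ ∑ j, ∑ k, (b j * x j ^ 2 + b k * x k ^ 2) / 2 := by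
        simp_rw [Finset.mul_sum]
        exact Finset.sum_le_sum fun j _ => Finset.sum_le_sum fun k _ => h j k
    _ = _ := by
        simp_rw [← Finset.sum_div, Finset.sum_add_distrib]
        simp [← Finset.mul_sum]

/-- Deviation from affinity along segments, weighted by the partial derivatives. -/
theorem norm_convexComb_sub_le (hr : 0 < r) (hE : DifferentiableOn ℂ E (Polydisk d r))
    (hb : ∀ x ∈ Polydisk d r, ∀ k, ‖cpd k E x‖ ≤ b k)
    {p q : EuclideanSpace ℂ (Fin d)} (hp : p ∈ Polydisk d (r / 4)) (hq : q ∈ Polydisk d (r / 4))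
    (hpq : 2 * ∑ k, ‖p k - q k‖ < r) {t : ℝ} (ht : t ∈ Icc (0 : ℝ) 1) :
    ‖(t * E p + (1 - t) * E q) - E (q + (t : ℂ) • (p - q))‖ ≤
      4 / r * (d * ∑ k, b k * ‖p k - q k‖ ^ 2) * (t * (1 - t)) := by
  have hsub : Polydisk d (r / 4) ⊆ Polydisk d r := mono (by linarith)
  have hb0 : ∀ k, 0 ≤ b k := fun k => (norm_nonneg _).trans (hb p (hsub hp) k)
  have h := norm_sub_convexComb_le (f := fun t : ℝ => E (q + (t : ℂ) • (p - q)))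
    (f' := fun t : ℝ => ∑ k, (p - q) k * cpd k E (q + (t : ℂ) • (p - q)))
    (K := 4 / r * (d * ∑ k, b k * ‖p k - q k‖ ^ 2))
    (fun t ht => (hasDerivAt_comp_line hE q (p - q)
      (hsub (add_smul_sub_mem hp hq ht))).comp_ofReal) ?_ ht
  · simpa using h
  intro s hs t ht
  have hst : |s - t| ≤ 1 := by
    rw [abs_le]
    constructor <;> linarith [hs.1, hs.2, ht.1, ht.2]
  have hdiff : ∀ k, ‖(q + (s : ℂ) • (p - q)) k - (q + (t : ℂ) • (p - q)) k‖ =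
      |s - t| * ‖p k - q k‖ := fun k => by
    rw [← Real.norm_eq_abs, ← Complex.norm_real, ← norm_mul]
    congr 1
    simp
    ring
  have hsmall : 2 * ∑ k, ‖(q + (s : ℂ) • (p - q)) k - (q + (t : ℂ) • (p - q)) k‖ < r := by
    refine lt_of_le_of_lt ?_ hpq
    gcongr with k
    rw [hdiff]
    exact mul_le_of_le_one_left (norm_nonneg _) hst
  rw [← Finset.sum_sub_distrib]
  calc ‖∑ j, ((p - q) j * cpd j E (q + (s : ℂ) • (p - q)) -
          (p - q) j * cpd j E (q + (t : ℂ) • (p - q)))‖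
      ≤ ∑ j, ‖p j - q j‖ * (4 / r * ∑ k, min (b j) (b k) * (|s - t| * ‖p k - q k‖)) := by
        refine (norm_sum_le _ _).trans (Finset.sum_le_sum fun j _ => ?_)
        rw [← mul_sub, norm_mul]
        refine mul_le_mul_of_nonneg_left ?_ (norm_nonneg _)
        simpa only [hdiff] using norm_cpd_sub_le_sum_min hr hE hb (add_smul_sub_mem hp hq hs)
          (add_smul_sub_mem hp hq ht) hsmall j
    _ = 4 / r * (∑ j, ‖p j - q j‖ * ∑ k, min (b j) (b k) * ‖p k - q k‖) * |s - t| := by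
        simp_rw [Finset.mul_sum, Finset.sum_mul]
        refine Finset.sum_congr rfl fun j _ => Finset.sum_congr rfl fun k _ => ?_
        ring
    _ ≤ _ := by
        gcongr
        exact sum_sum_min_mul_le hb0 fun k => ‖p k - q k‖

/-- Quantitative strong convexity of the disk. -/
theorem norm_add_mul_sub_lt (hρ : 0 < ρ) {u v : ℂ} (hu : ‖u‖ < ρ) (hv : ‖v‖ < ρ) {t : ℝ}
    (ht : t ∈ Icc (0 : ℝ) 1) :
    ‖v + t * (u - v)‖ < ρ - t * (1 - t) * (‖u - v‖ ^ 2 / (2 * ρ)) := by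
  have hid : ‖v + t * (u - v)‖ ^ 2 =
      t * ‖u‖ ^ 2 + (1 - t) * ‖v‖ ^ 2 - t * (1 - t) * ‖u - v‖ ^ 2 := by
    simp only [← Complex.normSq_eq_norm_sq, Complex.normSq_apply, Complex.add_re, Complex.add_im,
      Complex.mul_re, Complex.mul_im, Complex.sub_re, Complex.sub_im, Complex.ofReal_re,
      Complex.ofReal_im]
    ring
  set τ := t * (1 - t) * (‖u - v‖ ^ 2 / (2 * ρ)) with hτ
  have ht0 : 0 ≤ t * (1 - t) := mul_nonneg ht.1 (sub_nonneg.2 ht.2)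
  have hτρ : t * (1 - t) * ‖u - v‖ ^ 2 = 2 * ρ * τ := by
    rw [hτ]
    field_simp
  have hτ0 : 0 ≤ τ := by positivity
  have huv : ‖u - v‖ ≤ 2 * ρ := (norm_sub_le u v).trans (by linarith)
  have hτle : 2 * ρ * τ ≤ 2 * ρ * ρ := by
    rw [← hτρ]
    have h1 : ‖u - v‖ ^ 2 ≤ (2 * ρ) ^ 2 := by gcongr
    nlinarith [sq_nonneg (2 * t - 1), sq_nonneg ‖u - v‖]
  have hτle' : τ ≤ ρ := le_of_mul_le_mul_left hτle (by positivity)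
  have hu2 : ‖u‖ ^ 2 < ρ ^ 2 := by gcongr
  have hv2 : ‖v‖ ^ 2 < ρ ^ 2 := by gcongr
  have hlt : t * ‖u‖ ^ 2 + (1 - t) * ‖v‖ ^ 2 < ρ ^ 2 := by
    rcases ht.1.eq_or_lt with h | h
    · rw [← h]
      linarith
    · nlinarith [mul_lt_mul_of_pos_left hu2 h,
        mul_le_mul_of_nonneg_left hv2.le (sub_nonneg.2 ht.2)]
  refine lt_of_pow_lt_pow_left₀ 2 (by linarith) ?_
  rw [hid, hτρ]
  nlinarith [sq_nonneg τ]

theorem cpd_sub_linear {ψ : EuclideanSpace ℂ (Fin d) → ℂ} (a : Fin d → ℂ)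
    {x : EuclideanSpace ℂ (Fin d)} (hψ : DifferentiableAt ℂ ψ x) (k : Fin d) :
    cpd k (fun x => ψ x - ∑ j, a j * x j) x = cpd k ψ x - a k := by
  have hL : HasFDerivAt (fun x : EuclideanSpace ℂ (Fin d) => ∑ j, a j * x j)
      (∑ j, a j • (EuclideanSpace.proj j : EuclideanSpace ℂ (Fin d) →L[ℂ] ℂ)) x :=
    HasFDerivAt.fun_sum fun j _ =>
      (EuclideanSpace.proj j : EuclideanSpace ℂ (Fin d) →L[ℂ] ℂ).hasFDerivAt.const_mul (a j)
  rw [cpd, (hψ.hasFDerivAt.fun_sub hL).fderiv]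
  simp [cpd]

/-- Two points of a small polydisk are joined inside it by a path along which `ψ`, the sum of a
linear form and a small perturbation `E`, is affine. The path is the segment, corrected in the
direction `w` by the solution `s` of a fixed point equation. -/
theorem exists_path_affine_image {ψ : EuclideanSpace ℂ (Fin d) → ℂ} {a : Fin d → ℂ}
    (hd : 1 ≤ d) (hr : 0 < r) (hρ : 0 < ρ) (hρr : 8 * d * ρ < r)
    (hψ : DifferentiableOn ℂ ψ (Polydisk d r))
    (ha : ∀ x ∈ Polydisk d r, ∀ k, ‖cpd k ψ x - a k‖ < ‖a k‖ / 2)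
    {p q : EuclideanSpace ℂ (Fin d)} (hp : p ∈ Polydisk d ρ) (hq : q ∈ Polydisk d ρ) :
    ∃ γ : ℝ → EuclideanSpace ℂ (Fin d), ContinuousOn γ (Icc 0 1) ∧ γ 0 = q ∧ γ 1 = p ∧
      ∀ t ∈ Icc (0 : ℝ) 1, γ t ∈ Polydisk d ρ ∧ ψ (γ t) = t * ψ p + (1 - t) * ψ q := by
  rcases eq_or_ne p q with rfl | hne
  · exact ⟨fun _ => p, continuousOn_const, rfl, rfl, fun t _ => ⟨hp, by ring⟩⟩
  have hd' : (1 : ℝ) ≤ d := by exact_mod_cast hd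
  have hρr4 : ρ ≤ r / 4 := by nlinarith
  have hsub : Polydisk d ρ ⊆ Polydisk d r := mono (by linarith)
  have ha0 : ∀ k, 0 < ‖a k‖ := fun k => by
    linarith [(norm_nonneg _).trans_lt (ha p (hsub hp) k)]
  set E : EuclideanSpace ℂ (Fin d) → ℂ := fun x => ψ x - ∑ k, a k * x k with hEdef
  have hE : DifferentiableOn ℂ E (Polydisk d r) := hψ.fun_sub (by fun_prop)
  have hb : ∀ x ∈ Polydisk d r, ∀ k, ‖cpd k E x‖ ≤ ‖a k‖ / 2 := fun x hx k => by
    rw [cpd_sub_linear a (hψ.differentiableAt ((isOpen d r).mem_nhds hx))]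
    exact (ha x hx k).le
  set M : ℝ := ∑ k, ‖a k‖ * (‖p k - q k‖ ^ 2 / (2 * ρ)) with hM
  have hM0 : 0 < M := by
    obtain ⟨k, hk⟩ : ∃ k, p k ≠ q k := by
      by_contra! h
      exact hne (by ext k; exact h k)
    refine Finset.sum_pos' (fun k _ => by positivity) ⟨k, Finset.mem_univ k, ?_⟩
    have := norm_pos_iff.2 (sub_ne_zero.2 hk)
    have := ha0 k
    positivity
  set w : EuclideanSpace ℂ (Fin d) :=
    WithLp.toLp 2 fun k => ((‖p k - q k‖ ^ 2 / (2 * ρ) : ℝ) : ℂ) * ((‖a k‖ : ℂ) / a k) with hw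
  have hwk : ∀ k, w k = ((‖p k - q k‖ ^ 2 / (2 * ρ) : ℝ) : ℂ) * ((‖a k‖ : ℂ) / a k) :=
    fun k => rfl
  have haw : ∑ k, a k * w k = M := by
    rw [hM, Complex.ofReal_sum]
    refine Finset.sum_congr rfl fun k _ => ?_
    have hk : a k ≠ 0 := norm_pos_iff.1 (ha0 k)
    rw [hwk, Complex.ofReal_mul]
    field_simp
  have hwn : ∀ k, ‖w k‖ = ‖p k - q k‖ ^ 2 / (2 * ρ) := fun k => by
    rw [hwk, norm_mul, norm_div, Complex.norm_real, Complex.norm_real, norm_norm,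
      div_self (ha0 k).ne', mul_one, Real.norm_of_nonneg (by positivity)]
  have hbw : ∑ k, ‖a k‖ / 2 * ‖w k‖ = M / 2 := by
    rw [hM, Finset.sum_div]
    refine Finset.sum_congr rfl fun k _ => ?_
    rw [hwn]
    ring
  let x : ℝ → ℂ → EuclideanSpace ℂ (Fin d) := fun t s => q + (t : ℂ) • (p - q) + s • w
  let e : ℝ → ℂ := fun t => t * E p + (1 - t) * E q
  have hx : ∀ t ∈ Icc (0 : ℝ) 1, ∀ s : ℂ, ‖s‖ ≤ t * (1 - t) → x t s ∈ Polydisk d ρ := by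
    intro t ht s hs k
    have h1 := norm_add_mul_sub_lt hρ (hp k) (hq k) ht
    have h2 : ‖s * w k‖ ≤ t * (1 - t) * (‖p k - q k‖ ^ 2 / (2 * ρ)) := by
      rw [norm_mul, hwn]
      gcongr
    have h3 : x t s k = (q k + t * (p k - q k)) + s * w k := by simp [x]
    rw [h3]
    linarith [norm_add_le (q k + t * (p k - q k)) (s * w k)]
  have hxE : ∀ t ∈ Icc (0 : ℝ) 1, ∀ t' ∈ Icc (0 : ℝ) 1, ∀ s s' : ℂ, ‖s‖ ≤ t * (1 - t) →
      ‖s'‖ ≤ t' * (1 - t') → ‖E (x t s) - E (x t' s')‖ ≤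
        |t - t'| * (∑ k, ‖a k‖ / 2 * ‖p k - q k‖) + ‖s - s'‖ * (M / 2) := by
    intro t ht t' ht' s s' hs hs'
    refine (norm_sub_le_sum hE hb (hsub (hx t ht s hs)) (hsub (hx t' ht' s' hs'))).trans ?_
    rw [← hbw, Finset.mul_sum, Finset.mul_sum, ← Finset.sum_add_distrib]
    refine Finset.sum_le_sum fun k _ => ?_
    have h3 : x t s k - x t' s' k = ((t - t' : ℝ) : ℂ) * (p k - q k) + (s - s') * w k := by
      simp [x]
      ring
    have h4 : ‖x t s k - x t' s' k‖ ≤ |t - t'| * ‖p k - q k‖ + ‖s - s'‖ * ‖w k‖ := by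
      rw [h3]
      refine (norm_add_le _ _).trans_eq ?_
      rw [norm_mul, norm_mul, Complex.norm_real, Real.norm_eq_abs]
    calc _ ≤ ‖a k‖ / 2 * (|t - t'| * ‖p k - q k‖ + ‖s - s'‖ * ‖w k‖) := by gcongr
      _ = _ := by ring
  have hdev : ∀ t ∈ Icc (0 : ℝ) 1, ‖e t - E (x t 0)‖ ≤ M / 2 * (t * (1 - t)) := by
    intro t ht
    have hpq : 2 * ∑ k, ‖p k - q k‖ < r := by
      have h : ∑ k, ‖p k - q k‖ ≤ ∑ _k : Fin d, 2 * ρ :=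
        Finset.sum_le_sum fun k _ => (norm_sub_le _ _).trans (by linarith [hp k, hq k])
      simp only [Finset.sum_const, Finset.card_univ, Fintype.card_fin, nsmul_eq_mul] at h
      nlinarith
    have h := norm_convexComb_sub_le hr hE hb (mono hρr4 hp) (mono hρr4 hq) hpq ht
    have hx0 : x t 0 = q + (t : ℂ) • (p - q) := by simp [x]
    rw [hx0]
    refine h.trans (mul_le_mul_of_nonneg_right ?_ (mul_nonneg ht.1 (sub_nonneg.2 ht.2)))
    have h1 : ∑ k, ‖a k‖ / 2 * ‖p k - q k‖ ^ 2 = ρ * M := by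
      rw [hM, Finset.mul_sum]
      refine Finset.sum_congr rfl fun k _ => ?_
      field_simp
    rw [h1, div_mul_eq_mul_div, div_le_iff₀ hr]
    nlinarith
  have hMC : (M : ℂ) ≠ 0 := by exact_mod_cast hM0.ne'
  have hfix : ∀ t ∈ Icc (0 : ℝ) 1, ∃ s : ℂ, ‖s‖ ≤ t * (1 - t) ∧ M * s = e t - E (x t s) := by
    intro t ht
    have ht0 : 0 ≤ t * (1 - t) := mul_nonneg ht.1 (sub_nonneg.2 ht.2)
    have hmaps : MapsTo (fun s : ℂ => (e t - E (x t s)) / M) (closedBall 0 (t * (1 - t)))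
        (closedBall 0 (t * (1 - t))) := by
      intro s hs
      rw [mem_closedBall_zero_iff] at hs ⊢
      rw [norm_div, Complex.norm_of_nonneg hM0.le, div_le_iff₀ hM0]
      have h1 := hxE t ht t ht 0 s (by simpa using ht0) hs
      simp only [sub_self, abs_zero, zero_mul, zero_add, zero_sub, norm_neg] at h1
      calc ‖e t - E (x t s)‖ ≤ ‖e t - E (x t 0)‖ + ‖E (x t 0) - E (x t s)‖ :=
            norm_sub_le_norm_sub_add_norm_sub _ _ _
        _ ≤ M / 2 * (t * (1 - t)) + t * (1 - t) * (M / 2) :=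
            add_le_add (hdev t ht) (h1.trans (by gcongr))
        _ = _ := by ring
    have hcontr : ContractingWith (1 / 2) (hmaps.restrict _ _ _) := by
      refine ⟨by norm_num, LipschitzWith.of_dist_le_mul fun s s' => ?_⟩
      rw [Subtype.dist_eq, Subtype.dist_eq, MapsTo.val_restrict_apply, MapsTo.val_restrict_apply,
        dist_eq_norm_sub, dist_eq_norm_sub, ← sub_div, norm_div, Complex.norm_of_nonneg hM0.le,
        div_le_iff₀ hM0, sub_sub_sub_cancel_left]
      have h1 := hxE t ht t ht s' s (mem_closedBall_zero_iff.1 s'.2)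
        (mem_closedBall_zero_iff.1 s.2)
      rw [sub_self, abs_zero, zero_mul, zero_add, norm_sub_rev (s' : ℂ)] at h1
      refine h1.trans_eq ?_
      push_cast
      ring
    obtain ⟨s, hs, hfs, -⟩ := ContractingWith.exists_fixedPoint' isClosed_closedBall.isComplete
      hmaps hcontr (mem_closedBall_self ht0) (edist_ne_top _ _)
    refine ⟨s, mem_closedBall_zero_iff.1 hs, ?_⟩
    have h : (e t - E (x t s)) / M = s := hfs
    rw [div_eq_iff hMC] at h
    rw [h, mul_comm]
  choose! s hs hsM using hfix
  have hslip : ∀ t ∈ Icc (0 : ℝ) 1, ∀ t' ∈ Icc (0 : ℝ) 1, ‖s t - s t'‖ ≤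
      (‖E p - E q‖ + ∑ k, ‖a k‖ / 2 * ‖p k - q k‖) / (M / 2) * |t - t'| := by
    intro t ht t' ht'
    have h1 : M * (s t - s t') = ((t - t' : ℝ) : ℂ) * (E p - E q) - (E (x t (s t)) -
        E (x t' (s t'))) := by
      rw [mul_sub, hsM t ht, hsM t' ht']
      simp only [e]
      push_cast
      ring
    have h2 : M * ‖s t - s t'‖ ≤ |t - t'| * ‖E p - E q‖ + ‖E (x t (s t)) - E (x t' (s t'))‖ := by
      have h := congrArg norm h1
      rw [norm_mul, Complex.norm_of_nonneg hM0.le] at h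
      rw [h]
      refine (norm_sub_le _ _).trans_eq ?_
      rw [norm_mul, Complex.norm_real, Real.norm_eq_abs]
    have h3 := hxE t ht t' ht' _ _ (hs t ht) (hs t' ht')
    rw [div_mul_eq_mul_div, le_div_iff₀ (by positivity)]
    linarith
  have hscont : ContinuousOn s (Icc 0 1) := by
    refine (LipschitzOnWith.of_dist_le_mul (K := ⟨(‖E p - E q‖ +
      ∑ k, ‖a k‖ / 2 * ‖p k - q k‖) / (M / 2), by positivity⟩) fun t ht t' ht' => ?_).continuousOn
    rw [dist_eq_norm_sub, Real.dist_eq]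
    exact hslip t ht t' ht'
  have hs0 : s 0 = 0 := by simpa using hs 0 (by simp)
  have hs1 : s 1 = 0 := by simpa using hs 1 (by simp)
  refine ⟨fun t => x t (s t), ?_, by simp [x, hs0], by simp [x, hs1], fun t ht =>
    ⟨hx t ht _ (hs t ht), ?_⟩⟩
  · exact (by fun_prop : Continuous fun t : ℝ => q + (t : ℂ) • (p - q)).continuousOn.add
      (hscont.smul continuousOn_const)
  · have hψE : ∀ y, ψ y = E y + ∑ k, a k * y k := fun y => by simp [hEdef]
    have hlin : ∑ k, a k * x t (s t) k =
        t * ∑ k, a k * p k + (1 - t) * ∑ k, a k * q k + s t * M := by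
      rw [← haw, Finset.mul_sum, Finset.mul_sum, Finset.mul_sum, ← Finset.sum_add_distrib,
        ← Finset.sum_add_distrib]
      refine Finset.sum_congr rfl fun k _ => ?_
      simp [x]
      ring
    have h := hsM t ht
    simp only [e] at h
    rw [hψE (x t (s t)), hψE p, hψE q, hlin]
    linear_combination h

end Polydisk

/-- The second inner lemma in the proof of Lemma 7.30: there are constants
`F, D > 0` depending only on `d` such that if a holomorphic function `ψ` on the
polydisk `P_r` satisfies `|∂ψ/∂x_k − a_k| < |a_k|/F` everywhere on `P_r`, then
for `0 < ρ < r/D` the image `ψ(P_ρ)` is convex and each non-empty level set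
`ψ⁻¹(c) ∩ P_ρ` is connected. -/
theorem polydisk_convex_image_and_connected_level_sets
    (d : ℕ) (hd : 1 ≤ d) :
    ∃ F D : ℝ, 0 < F ∧ 0 < D ∧
      ∀ (r : ℝ), 0 < r →
        ∀ ψ : EuclideanSpace ℂ (Fin d) → ℂ,
          DifferentiableOn ℂ ψ (Polydisk d r) →
          ∀ a : Fin d → ℂ, ∀ c : ℂ,
          (∀ x ∈ Polydisk d r, ∀ k : Fin d, ‖cpd k ψ x - a k‖ < ‖a k‖ / F) →
          ∀ ρ : ℝ, 0 < ρ → ρ < r / D →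
            Convex ℝ (ψ '' Polydisk d ρ) ∧
            ((ψ ⁻¹' {c} ∩ Polydisk d ρ).Nonempty →
              IsConnected (ψ ⁻¹' {c} ∩ Polydisk d ρ)) := by
  have hd' : (1 : ℝ) ≤ d := by exact_mod_cast hd
  refine ⟨2, 8 * d, by norm_num, by positivity, fun r hr ψ hψ a c ha ρ hρ hρr => ?_⟩
  rw [lt_div_iff₀ (by positivity), mul_comm] at hρr
  constructor
  · rintro _ ⟨p, hp, rfl⟩ _ ⟨q, hq, rfl⟩ t u ht hu htu
    obtain ⟨γ, -, -, -, hγ⟩ := Polydisk.exists_path_affine_image hd hr hρ hρr hψ ha hp hq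
    obtain ⟨hmem, hval⟩ := hγ t ⟨ht, by linarith⟩
    refine ⟨γ t, hmem, ?_⟩
    obtain rfl : u = 1 - t := by linarith
    rw [hval, Complex.real_smul, Complex.real_smul]
    push_cast
    rfl
  · intro hne
    refine IsPathConnected.isConnected (isPathConnected_iff.2 ⟨hne, fun q hq p hp => ?_⟩)
    obtain ⟨γ, hcont, h0, h1, hγ⟩ :=
      Polydisk.exists_path_affine_image hd hr hρ hρr hψ ha hp.2 hq.2
    refine JoinedIn.ofLine hcont h0 h1 ?_
    rintro _ ⟨t, ht, rfl⟩
    obtain ⟨hmem, hval⟩ := hγ t ht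
    have hpc : ψ p = c := hp.1
    have hqc : ψ q = c := hq.1
    refine ⟨?_, hmem⟩
    rw [Set.mem_preimage, hval, hpc, hqc, Set.mem_singleton_iff]
    ring
end
end

section
/- Let 0 < ε < 1 and let φ be a holomorphic, nowhere-vanishing function on the annulus {λ ∈ ℂ : ε < |λ| < 1/ε} whose index ind φ = (1/(2πi))·∮_{|λ|=1} φ′(λ)/φ(λ) dλ equals 0. Then there exists exactly one pair (m₊, m₋) such that: m₊ is holomorphic and nowhere vanishing on {|λ| < 1/ε} with m₊(0) = 1; m₋ is holomorphic and nowhere vanishing on {λ ∈ ℂ : |λ| > ε}, and λ ↦ m₋(1/λ) on {0 < |λ| < 1/ε} extends holomorphically and without zeros across 0; and φ(λ) = m₊(λ)/m₋(λ) for all λ in the annulus. (Existence and uniqueness of the multiplicative Riemann factorization operators 𝕄₊, 𝕄₋ of Section 12: m₊ = 𝕄₊φ, m₋ = 𝕄₋φ.) -/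
noncomputable section

/-- The open annulus `{λ : ε < |λ| < 1/ε}`. -/
def Annulus (ε : ℝ) : Set ℂ := {l | ε < ‖l‖ ∧ ‖l‖ < 1 / ε}

/-- The index (winding number around 0) of a function along the unit circle:
`ind φ = (1/(2πi)) ∮_{|λ|=1} φ'(λ)/φ(λ) dλ`. -/
def ind (φ : ℂ → ℂ) : ℂ :=
  (2 * Real.pi * Complex.I)⁻¹ * ∮ z in C(0, 1), deriv φ z / φ z

open Complex Metric Set Filter Topology in
/-- Change of variables `z = 1 / s` in a circle integral. -/
theorem circleIntegral_eq_circleIntegral_inv (f : ℂ → ℂ) {r : ℝ} (hr : 0 < r) :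
    (∮ z in C(0, r), f z) = ∮ s in C(0, r⁻¹), (s ^ 2)⁻¹ * f s⁻¹ := by
  have hinv (θ : ℝ) : circleMap 0 r (2 * Real.pi - θ) = (circleMap 0 r⁻¹ θ)⁻¹ := by
    simp only [circleMap, zero_add, mul_inv, ofReal_inv, inv_inv, ← Complex.exp_neg]
    congr 1
    rw [show ((2 * Real.pi - θ : ℝ) : ℂ) * I = -(θ * I) + 2 * Real.pi * I by push_cast; ring,
      Complex.exp_periodic]
  have hsub := intervalIntegral.integral_comp_sub_left (a := 0) (b := 2 * Real.pi)
    (fun θ => deriv (circleMap 0 r) θ • f (circleMap 0 r θ)) (2 * Real.pi)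
  rw [sub_self, sub_zero] at hsub
  rw [circleIntegral, circleIntegral, ← hsub]
  refine intervalIntegral.integral_congr fun θ _ => ?_
  have hne : circleMap 0 r⁻¹ θ ≠ 0 := circleMap_ne_center (inv_ne_zero hr.ne')
  simp only [deriv_circleMap, hinv, smul_eq_mul]
  field_simp

/-- The open annulus centred at `0` with radii `a` and `b`. -/
def openAnnulus (a b : ℝ) : Set ℂ := {z | a < ‖z‖ ∧ ‖z‖ < b}

theorem isOpen_openAnnulus (a b : ℝ) : IsOpen (openAnnulus a b) :=
  (isOpen_lt continuous_const continuous_norm).inter (isOpen_lt continuous_norm continuous_const)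

theorem isPreconnected_openAnnulus {a : ℝ} (ha : 0 ≤ a) (b : ℝ) :
    IsPreconnected (openAnnulus a b) := by
  have himage : openAnnulus a b =
      (fun p : ℝ × ℝ => circleMap 0 p.1 p.2) '' (Set.Ioo a b ×ˢ Set.univ) := by
    ext z
    constructor
    · intro hz
      refine ⟨(‖z‖, Complex.arg z), ⟨hz, trivial⟩, ?_⟩
      simp [circleMap]
    · rintro ⟨⟨r, θ⟩, ⟨⟨h1, h2⟩, -⟩, rfl⟩
      simp only at h1 h2
      simp only [openAnnulus, Set.mem_ofPred_eq, norm_circleMap_zero, abs_of_pos (ha.trans_lt h1)]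
      exact ⟨h1, h2⟩
  rw [himage]
  refine (isPreconnected_Ioo.prod isPreconnected_univ).image _ (Continuous.continuousOn ?_)
  simp only [circleMap]
  fun_prop

open Complex Metric Set Filter Topology in
/-- Circle integrals of a function holomorphic on an annulus do not depend on the radius. -/
theorem circleIntegral_eq_of_differentiableOn_openAnnulus {a b r R : ℝ} (ha : 0 ≤ a) {f : ℂ → ℂ}
    (hf : DifferentiableOn ℂ f (openAnnulus a b)) (har : a < r) (hrb : r < b)
    (haR : a < R) (hRb : R < b) :
    (∮ z in C(0, R), f z) = ∮ z in C(0, r), f z := by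
  wlog hle : r ≤ R generalizing r R
  · exact (this haR hRb har hrb (not_le.1 hle).le).symm
  refine circleIntegral_eq_of_differentiable_on_annulus_off_countable (ha.trans_lt har) hle
    countable_empty (hf.continuousOn.mono fun z hz => ?_) fun z hz =>
      hf.differentiableAt ((isOpen_openAnnulus a b).mem_nhds ?_)
  · simp only [Set.mem_sdiff, mem_closedBall, mem_ball, dist_zero_right, not_lt] at hz
    exact ⟨har.trans_le hz.2, hz.1.trans_lt hRb⟩
  · simp only [Set.mem_sdiff, mem_closedBall, mem_ball, dist_zero_right, not_le] at hz
    exact ⟨har.trans hz.1.2, hz.1.1.trans hRb⟩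

open Complex Metric Set Filter Topology in
/-- The Cauchy kernel at a point outside the disc integrates to zero. -/
theorem circleIntegral_sub_inv_of_lt_norm {r : ℝ} (hr : 0 ≤ r) {w : ℂ} (hw : r < ‖w‖) :
    (∮ z in C(0, r), (z - w)⁻¹) = 0 := by
  have hne : ∀ z ∈ closedBall (0 : ℂ) r, z - w ≠ 0 := fun z hz h => by
    rw [mem_closedBall_zero_iff, sub_eq_zero.1 h] at hz
    linarith
  refine circleIntegral_eq_zero_of_differentiable_on_off_countable hr countable_empty
    ((continuousOn_id.sub continuousOn_const).inv₀ hne) fun z hz => ?_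
  exact (differentiableAt_id.sub_const w).inv (hne z (ball_subset_closedBall hz.1))

theorem sphere_subset_openAnnulus {a b R : ℝ} (ha : a < R) (hb : R < b) :
    Metric.sphere (0 : ℂ) R ⊆ openAnnulus a b := fun z hz => by
  rw [mem_sphere_zero_iff_norm] at hz
  exact ⟨hz ▸ ha, hz ▸ hb⟩

open Complex Metric Set Filter Topology in
/-- **Cauchy integral formula** on an annulus. -/
theorem circleIntegral_sub_circleIntegral_of_differentiableOn_openAnnulus {a b r R : ℝ}
    (ha : 0 ≤ a) {f : ℂ → ℂ} (hf : DifferentiableOn ℂ f (openAnnulus a b)) {w : ℂ}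
    (har : a < r) (hrw : r < ‖w‖) (hwR : ‖w‖ < R) (hRb : R < b) :
    (∮ z in C(0, R), (z - w)⁻¹ * f z) - (∮ z in C(0, r), (z - w)⁻¹ * f z) =
      2 * Real.pi * I * f w := by
  have hw : w ∈ openAnnulus a b := ⟨har.trans hrw, hwR.trans hRb⟩
  have hd : DifferentiableOn ℂ (dslope f w) (openAnnulus a b) :=
    (differentiableOn_dslope ((isOpen_openAnnulus a b).mem_nhds hw)).2 hf
  have hsplit : ∀ ρ : ℝ, a < ρ → ρ < b → ρ ≠ ‖w‖ →
      (∮ z in C(0, ρ), dslope f w z) =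
        (∮ z in C(0, ρ), (z - w)⁻¹ * f z) - (∮ z in C(0, ρ), (z - w)⁻¹) * f w := by
    intro ρ h1 h2 h3
    have hρ : 0 ≤ ρ := ha.trans h1.le
    have hne : ∀ z ∈ sphere (0 : ℂ) ρ, z - w ≠ 0 := fun z hz h => by
      rw [mem_sphere_zero_iff_norm, sub_eq_zero.1 h] at hz
      exact h3 hz.symm
    have hc : ContinuousOn (fun z : ℂ => (z - w)⁻¹) (sphere 0 ρ) :=
      (continuousOn_id.sub continuousOn_const).inv₀ hne
    have hfc : ContinuousOn f (sphere 0 ρ) :=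
      hf.continuousOn.mono (sphere_subset_openAnnulus h1 h2)
    have hi₁ : CircleIntegrable (fun z => (z - w)⁻¹ * f z) 0 ρ :=
      (hc.mul hfc).circleIntegrable hρ
    have hi₂ : CircleIntegrable (fun z => f w * (z - w)⁻¹) 0 ρ :=
      (continuousOn_const.mul hc).circleIntegrable hρ
    rw [mul_comm, ← circleIntegral.integral_const_mul, ← circleIntegral.integral_sub hi₁ hi₂]
    refine circleIntegral.integral_congr hρ fun z hz => ?_
    simp only [dslope_of_ne f (sub_ne_zero.1 (hne z hz)), slope_def_module, smul_eq_mul]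
    ring
  have h := circleIntegral_eq_of_differentiableOn_openAnnulus ha hd har (hrw.trans hw.2)
    (har.trans (hrw.trans hwR)) hRb
  rw [hsplit R (hw.1.trans hwR) hRb hwR.ne', hsplit r har (hrw.trans hw.2) hrw.ne,
    circleIntegral.integral_sub_inv_of_mem_ball (by simpa using hwR),
    circleIntegral_sub_inv_of_lt_norm (ha.trans har.le) hrw] at h
  linear_combination h

open Complex Metric Set Filter Topology in
/-- The Cauchy integrals over the circles of an annulus glue to a holomorphic function on the
disc bounded by the outer circle. -/
theorem exists_differentiableOn_ball_eq_circleIntegral {a b : ℝ} (ha : 0 ≤ a) (hab : a < b)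
    {f : ℂ → ℂ} (hf : DifferentiableOn ℂ f (openAnnulus a b)) :
    ∃ g : ℂ → ℂ, DifferentiableOn ℂ g (ball 0 b) ∧
      ∀ w R, a < R → ‖w‖ < R → R < b →
        (∮ z in C(0, R), (z - w)⁻¹ * f z) = 2 * Real.pi * I * g w := by
  let ρ : ℂ → ℝ := fun w => (max ‖w‖ a + b) / 2
  let g : ℂ → ℂ := fun w => (2 * Real.pi * I)⁻¹ * ∮ z in C(0, ρ w), (z - w)⁻¹ * f z
  have hρ : ∀ w, ‖w‖ < b → max ‖w‖ a < ρ w ∧ ρ w < b := fun w hw => by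
    have := max_lt hw hab
    constructor <;> simp only [ρ] <;> linarith
  have hg : ∀ w R, a < R → ‖w‖ < R → R < b →
      g w = (2 * Real.pi * I)⁻¹ * ∮ z in C(0, R), (z - w)⁻¹ * f z := by
    intro w R haR hwR hRb
    obtain ⟨h1, h2⟩ := hρ w (hwR.trans hRb)
    have hd : DifferentiableOn ℂ (fun z => (z - w)⁻¹ * f z) (openAnnulus (max ‖w‖ a) b) := by
      refine DifferentiableOn.mul (fun z hz => ?_)
        (hf.mono fun z hz => ⟨(le_max_right _ _).trans_lt hz.1, hz.2⟩)
      refine ((differentiableAt_id.sub_const w).inv fun h => ?_).differentiableWithinAt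
      have := (le_max_left _ _).trans_lt hz.1
      rw [← sub_eq_zero.1 h] at this
      exact lt_irrefl _ this
    simp only [g]
    rw [circleIntegral_eq_of_differentiableOn_openAnnulus (ha.trans (le_max_right _ _)) hd
      (max_lt hwR haR) hRb h1 h2]
  refine ⟨g, fun w hw => ?_, fun w R haR hwR hRb => ?_⟩
  · rw [mem_ball_zero_iff] at hw
    obtain ⟨h1, h2⟩ := hρ w hw
    have h0 : 0 < ρ w := (ha.trans (le_max_right _ _)).trans_lt h1
    have hint : CircleIntegrable f 0 (ρ w) := (hf.continuousOn.mono
      (sphere_subset_openAnnulus ((le_max_right _ _).trans_lt h1) h2)).circleIntegrable h0.le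
    have hdiff : DifferentiableOn ℂ
        (fun u => (2 * Real.pi * I)⁻¹ • ∮ z in C(0, ρ w), (z - u)⁻¹ • f z) (ball 0 (ρ w)) := by
      have := (hasFPowerSeriesOn_cauchy_integral (R := ⟨ρ w, h0.le⟩) hint h0).differentiableOn
      rwa [Metric.eball_coe (ε := ⟨ρ w, h0.le⟩)] at this
    have hmem : ball (0 : ℂ) (ρ w) ∈ 𝓝 w :=
      isOpen_ball.mem_nhds (by simpa using (le_max_left _ _).trans_lt h1)
    refine DifferentiableAt.differentiableWithinAt
      ((hdiff.differentiableAt hmem).congr_of_eventuallyEq ?_)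
    filter_upwards [hmem] with u hu
    simpa using hg u (ρ w) ((le_max_right _ _).trans_lt h1) (by simpa using hu) h2
  · rw [hg w R haR hwR hRb, mul_inv_cancel_left₀ two_pi_I_ne_zero]

theorem inv_mem_openAnnulus {a b : ℝ} (ha : 0 < a) (hab : a < b) {z : ℂ} :
    z⁻¹ ∈ openAnnulus a b ↔ z ∈ openAnnulus b⁻¹ a⁻¹ := by
  simp only [openAnnulus, Set.mem_ofPred_eq, norm_inv]
  rcases eq_or_ne z 0 with rfl | hz
  · simp [ha.not_gt, (ha.trans hab).not_gt]
  · have hz' := norm_pos_iff.2 hz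
    rw [lt_inv_comm₀ ha hz', inv_lt_comm₀ hz' (ha.trans hab), and_comm]

theorem inv_sub_inv_eq_sub_mul_inv_sub {s w : ℂ} (hs : s ≠ 0) (hw : w ≠ 0) (hsw : s - w⁻¹ ≠ 0) :
    (s⁻¹ - w)⁻¹ = -w⁻¹ - (w ^ 2)⁻¹ * (s - w⁻¹)⁻¹ := by
  have hsw' : s * w - 1 ≠ 0 := fun h => hsw (by field_simp; simpa using h)
  rw [show s⁻¹ - w = -((s * w - 1) / s) by field_simp; ring,
    show s - w⁻¹ = (s * w - 1) / w by field_simp]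
  field_simp
  ring

open Complex Metric Set Filter Topology in
/-- The Cauchy integral of `f` at an exterior point, expressed through `F s = s⁻² * f s⁻¹`, when
`F` has vanishing residue. -/
theorem circleIntegral_sub_inv_mul_eq_circleIntegral_inv {r : ℝ} (hr : 0 < r) {w : ℂ}
    (hrw : r < ‖w‖) {f : ℂ → ℂ} (hF : ContinuousOn (fun s => (s ^ 2)⁻¹ * f s⁻¹) (sphere 0 r⁻¹))
    (hF0 : (∮ s in C(0, r⁻¹), (s ^ 2)⁻¹ * f s⁻¹) = 0) :
    (∮ z in C(0, r), (z - w)⁻¹ * f z) =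
      -((w ^ 2)⁻¹ * ∮ s in C(0, r⁻¹), (s - w⁻¹)⁻¹ * ((s ^ 2)⁻¹ * f s⁻¹)) := by
  have hw0 : w ≠ 0 := norm_pos_iff.1 (hr.trans hrw)
  have hri := inv_pos.2 hr
  have hsne : ∀ s ∈ sphere (0 : ℂ) r⁻¹, s - w⁻¹ ≠ 0 := fun s hs h => by
    rw [mem_sphere_zero_iff_norm, sub_eq_zero.1 h, norm_inv] at hs
    exact (inv_strictAnti₀ hr hrw).ne hs
  have hc : ContinuousOn (fun s : ℂ => (s - w⁻¹)⁻¹) (sphere 0 r⁻¹) :=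
    (continuousOn_id.sub continuousOn_const).inv₀ hsne
  have hi₁ : CircleIntegrable (fun s => -w⁻¹ * ((s ^ 2)⁻¹ * f s⁻¹)) 0 r⁻¹ :=
    (continuousOn_const.mul hF).circleIntegrable hri.le
  have hi₂ : CircleIntegrable
      (fun s => (w ^ 2)⁻¹ * ((s - w⁻¹)⁻¹ * ((s ^ 2)⁻¹ * f s⁻¹))) 0 r⁻¹ :=
    (continuousOn_const.mul (hc.mul hF)).circleIntegrable hri.le
  have hsum := circleIntegral.integral_sub hi₁ hi₂
  rw [circleIntegral.integral_const_mul, circleIntegral.integral_const_mul, hF0, mul_zero,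
    zero_sub] at hsum
  rw [circleIntegral_eq_circleIntegral_inv _ hr, ← hsum]
  refine circleIntegral.integral_congr hri.le fun s hs => ?_
  have hs0 : s ≠ 0 := ne_of_mem_sphere hs hri.ne'
  simp only [inv_sub_inv_eq_sub_mul_inv_sub hs0 hw0 (hsne s hs)]
  ring

open Complex Metric Set Filter Topology in
/-- **Laurent decomposition** of a function with vanishing residue. -/
theorem exists_laurent_decomposition_of_circleIntegral_eq_zero {a b r₀ : ℝ} (ha : 0 < a)
    (har₀ : a < r₀) (hr₀b : r₀ < b) {f : ℂ → ℂ} (hf : DifferentiableOn ℂ f (openAnnulus a b))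
    (hres : (∮ z in C(0, r₀), f z) = 0) :
    ∃ g h : ℂ → ℂ, DifferentiableOn ℂ g (ball 0 b) ∧ DifferentiableOn ℂ h (ball 0 a⁻¹) ∧
      ∀ w ∈ openAnnulus a b, f w = g w + (w ^ 2)⁻¹ * h w⁻¹ := by
  have hab := har₀.trans hr₀b
  have hb := ha.trans hab
  let F : ℂ → ℂ := fun s => (s ^ 2)⁻¹ * f s⁻¹
  have hne : ∀ s ∈ openAnnulus b⁻¹ a⁻¹, s ≠ 0 := fun s hs =>
    norm_pos_iff.1 ((inv_pos.2 hb).trans hs.1)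
  have hF : DifferentiableOn ℂ F (openAnnulus b⁻¹ a⁻¹) := by
    refine DifferentiableOn.mul (fun s hs => ?_) (hf.comp (fun s hs => ?_) fun s hs => ?_)
    · exact ((differentiableAt_id.pow 2).inv (pow_ne_zero 2 (hne s hs))).differentiableWithinAt
    · exact (differentiableAt_inv (hne s hs)).differentiableWithinAt
    · exact (inv_mem_openAnnulus ha hab).2 hs
  obtain ⟨g, hg, hgi⟩ := exists_differentiableOn_ball_eq_circleIntegral ha.le hab hf
  obtain ⟨h, hh, hhi⟩ := exists_differentiableOn_ball_eq_circleIntegral (inv_pos.2 hb).le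
    (inv_strictAnti₀ ha hab) hF
  refine ⟨g, h, hg, hh, fun w hw => ?_⟩
  obtain ⟨r, har, hrw⟩ := exists_between hw.1
  obtain ⟨R, hwR, hRb⟩ := exists_between hw.2
  have hr : 0 < r := ha.trans har
  have hw0 : w ≠ 0 := norm_pos_iff.1 (hr.trans hrw)
  have hri : b⁻¹ < r⁻¹ := inv_strictAnti₀ hr (hrw.trans hw.2)
  have hri' : r⁻¹ < a⁻¹ := inv_strictAnti₀ ha har
  have hwi : ‖w⁻¹‖ < r⁻¹ := by
    rw [norm_inv]
    exact inv_strictAnti₀ hr hrw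
  have hF0 : (∮ s in C(0, r⁻¹), F s) = 0 := by
    rw [← circleIntegral_eq_circleIntegral_inv f hr]
    exact (circleIntegral_eq_of_differentiableOn_openAnnulus ha.le hf har₀ hr₀b har
      (hrw.trans hw.2)).trans hres
  have hinner : (∮ z in C(0, r), (z - w)⁻¹ * f z) =
      -((w ^ 2)⁻¹ * ∮ s in C(0, r⁻¹), (s - w⁻¹)⁻¹ * F s) :=
    circleIntegral_sub_inv_mul_eq_circleIntegral_inv hr hrw
      (hF.continuousOn.mono (sphere_subset_openAnnulus hri hri')) hF0
  have hcauchy := circleIntegral_sub_circleIntegral_of_differentiableOn_openAnnulus ha.le hf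
    har hrw hwR hRb
  rw [hinner, hgi w R (hw.1.trans hwR) hwR hRb, hhi w⁻¹ r⁻¹ hri hwi hri'] at hcauchy
  refine mul_left_cancel₀ two_pi_I_ne_zero ?_
  linear_combination -hcauchy

open Complex Metric Set Filter Topology in
/-- A nowhere-vanishing holomorphic function on an annulus whose logarithmic derivative has
vanishing residue is a constant multiple of `exp (G w - K w⁻¹)`, with `G` and `K` holomorphic on
discs. -/
theorem exists_eq_const_mul_exp_sub_of_circleIntegral_logDeriv_eq_zero {a b r₀ : ℝ} (ha : 0 < a)
    (har₀ : a < r₀) (hr₀b : r₀ < b) {f : ℂ → ℂ} (hf : DifferentiableOn ℂ f (openAnnulus a b))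
    (hf0 : ∀ z ∈ openAnnulus a b, f z ≠ 0) (hres : (∮ z in C(0, r₀), logDeriv f z) = 0) :
    ∃ (c : ℂ) (G K : ℂ → ℂ), c ≠ 0 ∧ G 0 = 0 ∧ DifferentiableOn ℂ G (ball 0 b) ∧
      DifferentiableOn ℂ K (ball 0 a⁻¹) ∧
      ∀ w ∈ openAnnulus a b, f w = c * exp (G w - K w⁻¹) := by
  have hopen := isOpen_openAnnulus a b
  have hab := har₀.trans hr₀b
  obtain ⟨g, h, hg, hh, hgh⟩ := exists_laurent_decomposition_of_circleIntegral_eq_zero ha har₀ hr₀b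
    ((hf.deriv hopen).div hf hf0) hres
  obtain ⟨G, hG0, hG⟩ := hg.isExactOn_ball.with_val_at 0 0
  obtain ⟨K, hK⟩ := hh.isExactOn_ball
  have hderiv : ∀ w ∈ openAnnulus a b,
      HasDerivAt (fun w => exp (G w - K w⁻¹))
        (exp (G w - K w⁻¹) * (g w + (w ^ 2)⁻¹ * h w⁻¹)) w := by
    intro w hw
    have hw0 : w ≠ 0 := norm_pos_iff.1 (ha.trans hw.1)
    have hwi : w⁻¹ ∈ ball (0 : ℂ) a⁻¹ := by
      rw [mem_ball_zero_iff, norm_inv]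
      exact inv_strictAnti₀ ha hw.1
    have hKw := (hK w⁻¹ hwi).comp w (hasDerivAt_inv hw0)
    refine ((hG w (by simpa using hw.2)).sub hKw).cexp.congr_deriv ?_
    simp only [Pi.sub_apply, Function.comp_apply]
    ring
  obtain ⟨c, hc, hfc⟩ := (logDeriv_eqOn_iff hf
    (fun w hw => (hderiv w hw).differentiableAt.differentiableWithinAt) hopen
    (isPreconnected_openAnnulus ha.le b) (fun w _ => exp_ne_zero _) hf0).1 fun w hw => by
      rw [logDeriv_apply (fun w => exp (G w - K w⁻¹)), (hderiv w hw).deriv,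
        mul_div_cancel_left₀ _ (exp_ne_zero _)]
      exact hgh w hw
  exact ⟨c, G, K, hc, hG0, fun z hz => (hG z hz).differentiableAt.differentiableWithinAt,
    fun z hz => (hK z hz).differentiableAt.differentiableWithinAt, fun w hw => hfc hw⟩

open Complex Metric Set Filter Topology in
/-- A function holomorphic on `{‖z‖ < b}` that agrees on an annulus with a function holomorphic on
`{a < ‖z‖}` having a limit at infinity is constant, and so is the latter function. -/
theorem eqOn_const_of_eqOn_openAnnulus {a b : ℝ} (hab : a < b) {u v : ℂ → ℂ} {l : ℂ}
    (hu : DifferentiableOn ℂ u (ball 0 b)) (hv : DifferentiableOn ℂ v {z : ℂ | a < ‖z‖})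
    (huv : EqOn u v (openAnnulus a b)) (hl : Tendsto v (cocompact ℂ) (𝓝 l)) :
    (∀ z ∈ ball (0 : ℂ) b, u z = l) ∧ ∀ z : ℂ, a < ‖z‖ → v z = l := by
  classical
  let H : ℂ → ℂ := fun z => if ‖z‖ < b then u z else v z
  have hHu : EqOn H u (ball 0 b) := fun z hz => if_pos (by simpa using hz)
  have hHv : EqOn H v {z : ℂ | a < ‖z‖} := fun z hz => by
    by_cases h : ‖z‖ < b
    · exact (if_pos h).trans (huv ⟨hz, h⟩)
    · exact if_neg h
  have hopen : IsOpen {z : ℂ | a < ‖z‖} := isOpen_lt continuous_const continuous_norm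
  have hH : Differentiable ℂ H := fun z => by
    by_cases h : ‖z‖ < b
    · exact (hu.congr hHu).differentiableAt (isOpen_ball.mem_nhds (by simpa using h))
    · exact (hv.congr hHv).differentiableAt (hopen.mem_nhds (hab.trans_le (not_lt.1 h)))
  have hHl : Tendsto H (cocompact ℂ) (𝓝 l) := hl.congr' <| by
    filter_upwards [tendsto_norm_cocompact_atTop.eventually_gt_atTop a] with z hz
    exact (hHv hz).symm
  exact ⟨fun z hz => (hHu hz).symm.trans (hH.apply_eq_of_tendsto_cocompact z hHl),
    fun z hz => (hHv hz).symm.trans (hH.apply_eq_of_tendsto_cocompact z hHl)⟩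

/-- Existence and uniqueness of the multiplicative Riemann factorization
(Section 12): a nowhere-vanishing holomorphic `φ` on the annulus with index `0`
factors uniquely as `φ = m₊/m₋` with `m₊` holomorphic and nonvanishing on the
disk `{|λ| < 1/ε}`, `m₊(0) = 1`, and `m₋` holomorphic and nonvanishing on
`{|λ| > ε}` including at infinity. -/
theorem multiplicative_riemann_factorization
    (ε : ℝ) (hε0 : 0 < ε) (hε1 : ε < 1)
    (φ : ℂ → ℂ) (hφ : DifferentiableOn ℂ φ (Annulus ε))
    (hφ0 : ∀ l ∈ Annulus ε, φ l ≠ 0)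
    (hind : ind φ = 0) :
    ∃ mp mm : ℂ → ℂ,
      (DifferentiableOn ℂ mp (Metric.ball 0 (1 / ε)) ∧
        (∀ l ∈ Metric.ball (0 : ℂ) (1 / ε), mp l ≠ 0) ∧
        mp 0 = 1 ∧
        DifferentiableOn ℂ mm {l : ℂ | ε < ‖l‖} ∧
        (∀ l : ℂ, ε < ‖l‖ → mm l ≠ 0) ∧
        (∃ e : ℂ → ℂ, DifferentiableOn ℂ e (Metric.ball 0 (1 / ε)) ∧
          (∀ z ∈ Metric.ball (0 : ℂ) (1 / ε), e z ≠ 0) ∧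
          ∀ z : ℂ, z ≠ 0 → ‖z‖ < 1 / ε → e z = mm (1 / z)) ∧
        ∀ l ∈ Annulus ε, φ l = mp l / mm l) ∧
      ∀ mp' mm' : ℂ → ℂ,
        (DifferentiableOn ℂ mp' (Metric.ball 0 (1 / ε)) ∧
          (∀ l ∈ Metric.ball (0 : ℂ) (1 / ε), mp' l ≠ 0) ∧
          mp' 0 = 1 ∧
          DifferentiableOn ℂ mm' {l : ℂ | ε < ‖l‖} ∧
          (∀ l : ℂ, ε < ‖l‖ → mm' l ≠ 0) ∧
          (∃ e : ℂ → ℂ, DifferentiableOn ℂ e (Metric.ball 0 (1 / ε)) ∧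
            (∀ z ∈ Metric.ball (0 : ℂ) (1 / ε), e z ≠ 0) ∧
            ∀ z : ℂ, z ≠ 0 → ‖z‖ < 1 / ε → e z = mm' (1 / z)) ∧
          ∀ l ∈ Annulus ε, φ l = mp' l / mm' l) →
        Set.EqOn mp mp' (Metric.ball 0 (1 / ε)) ∧
          Set.EqOn mm mm' {l : ℂ | ε < ‖l‖} := by
  have hε : (0 : ℝ) < 1 / ε := one_div_pos.2 hε0
  have h1ε : 1 < 1 / ε := (one_lt_div hε0).2 hε1
  have hlt : ε < 1 / ε := hε1.trans h1ε
  have hmem0 : (0 : ℂ) ∈ Metric.ball (0 : ℂ) (1 / ε) := Metric.mem_ball_self hε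
  have hinv : ∀ z : ℂ, ε < ‖z‖ → z⁻¹ ∈ Metric.ball (0 : ℂ) (1 / ε) := fun z hz => by
    rw [mem_ball_zero_iff, norm_inv, one_div]
    exact inv_strictAnti₀ hε0 hz
  have hres : (∮ z in C(0, 1), logDeriv φ z) = 0 :=
    (mul_eq_zero.1 hind).resolve_left (inv_ne_zero Complex.two_pi_I_ne_zero)
  obtain ⟨c, G, K, hc, hG0, hG, hK, hφGK⟩ :=
    exists_eq_const_mul_exp_sub_of_circleIntegral_logDeriv_eq_zero hε0 hε1 h1ε hφ hφ0 hres
  rw [← one_div] at hK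
  refine ⟨fun z => Complex.exp (G z), fun z => c⁻¹ * Complex.exp (K z⁻¹),
    ⟨hG.cexp, fun _ _ => Complex.exp_ne_zero _, by simp [hG0], ?_,
      fun _ _ => mul_ne_zero (inv_ne_zero hc) (Complex.exp_ne_zero _),
      ⟨fun z => c⁻¹ * Complex.exp (K z), hK.cexp.const_mul _,
        fun _ _ => mul_ne_zero (inv_ne_zero hc) (Complex.exp_ne_zero _), fun z _ _ => by simp⟩,
      fun l hl => ?_⟩, ?_⟩
  · refine DifferentiableOn.const_mul (DifferentiableOn.cexp (hK.comp (fun z hz => ?_) hinv)) _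
    exact (differentiableAt_inv
      (norm_pos_iff.1 (hε0.trans (show ε < ‖z‖ from hz)))).differentiableWithinAt
  · rw [hφGK l hl, Complex.exp_sub]
    field_simp
  · rintro mp' mm' ⟨hmp, hmp0, hmp1, hmm, hmm0, ⟨e, he, he0, hemm⟩, hfac⟩
    have hmm' : ∀ z : ℂ, ε < ‖z‖ → mm' z = e z⁻¹ := fun z hz => by
      have hz0 : z ≠ 0 := norm_pos_iff.1 (hε0.trans hz)
      rw [hemm z⁻¹ (inv_ne_zero hz0) (by simpa using hinv z hz), one_div, inv_inv]
    have hquot : DifferentiableOn ℂ (fun z => c⁻¹ * Complex.exp (K z) / e z)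
        (Metric.ball 0 (1 / ε)) := (hK.cexp.const_mul _).div he he0
    have hu : DifferentiableOn ℂ (fun z => Complex.exp (G z) / mp' z)
        (Metric.ball 0 (1 / ε)) := hG.cexp.div hmp hmp0
    have hv : DifferentiableOn ℂ (fun z => c⁻¹ * Complex.exp (K z⁻¹) / e z⁻¹)
        {z : ℂ | ε < ‖z‖} := by
      refine hquot.comp (fun z hz => ?_) hinv
      exact (differentiableAt_inv
        (norm_pos_iff.1 (hε0.trans (show ε < ‖z‖ from hz)))).differentiableWithinAt
    have huv : Set.EqOn (fun z => Complex.exp (G z) / mp' z)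
        (fun z => c⁻¹ * Complex.exp (K z⁻¹) / e z⁻¹) (openAnnulus ε (1 / ε)) := fun z hz => by
      have h := hfac z hz
      have h1 := hmp0 z (by simpa using hz.2)
      have h2 := he0 z⁻¹ (hinv z hz.1)
      rw [hφGK z hz, hmm' z hz.1, Complex.exp_sub] at h
      have h3 := Complex.exp_ne_zero (K z⁻¹)
      field_simp at h ⊢
      linear_combination h
    have hl : Filter.Tendsto (fun z => c⁻¹ * Complex.exp (K z⁻¹) / e z⁻¹) (Filter.cocompact ℂ)
        (nhds (c⁻¹ * Complex.exp (K 0) / e 0)) :=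
      (hquot.differentiableAt (Metric.isOpen_ball.mem_nhds hmem0)).continuousAt.tendsto.comp
        (Metric.cobounded_eq_cocompact (α := ℂ) ▸ Filter.tendsto_inv₀_cobounded)
    obtain ⟨hul, hvl⟩ := eqOn_const_of_eqOn_openAnnulus hlt hu hv huv hl
    have hone : c⁻¹ * Complex.exp (K 0) / e 0 = 1 := by
      rw [← hul 0 hmem0, hG0, hmp1]
      simp
    rw [hone] at hul hvl
    refine ⟨fun z hz => (div_eq_one_iff_eq (hmp0 z hz)).1 (hul z hz), fun z hz => ?_⟩
    rw [hmm' z hz]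
    exact (div_eq_one_iff_eq (he0 _ (hinv z hz))).1 (hvl z hz)
end
end
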